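/- arXiv:2012.14382 — 7 statements merged into one kernel-verified Lean document; each statement's English description precedes it below -/
import Mathlib

section
/- Let H be a complex Hilbert space, let A and B be bounded linear operators on H, and let s be a real number. Then B·exp(isA) − exp(isA)·B = i ∫₀ˢ exp(i(s−u)A)·(BA − AB)·exp(iuA) du, where the integral is a Bochner integral in the space of bounded operators on H and exp denotes the operator exponential. -/
open scoped Complex

/-- For bounded operators `A B` on a complex Hilbert space and `s : ℝ`,
`B * exp(isA) - exp(isA) * B = i ∫₀ˢ exp(i(s-u)A) * (BA - AB) * exp(iuA) du`. -/
theorem commutator_exp_eq_integral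
    {H : Type*} [NormedAddCommGroup H] [InnerProductSpace ℂ H] [CompleteSpace H]
    (A B : H →L[ℂ] H) (s : ℝ) :
    B * NormedSpace.exp ((Complex.I * s) • A)
      - NormedSpace.exp ((Complex.I * s) • A) * B
    = Complex.I • ∫ u in (0:ℝ)..s,
        NormedSpace.exp ((Complex.I * (s - u)) • A) * (B * A - A * B)
          * NormedSpace.exp ((Complex.I * u) • A) := by
  have h1 : ∀ u : ℝ, HasDerivAt (fun u : ℝ => NormedSpace.exp ((Complex.I * u) • A))
      (Complex.I • (A * NormedSpace.exp ((Complex.I * u) • A))) u := by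
    intro u
    have h := hasDerivAt_exp_smul_const' (𝕂 := ℂ) A (Complex.I * u)
    have hg : HasDerivAt (fun u : ℝ => Complex.I * (u : ℂ)) Complex.I u := by
      simpa using (Complex.ofRealCLM.hasDerivAt (x := u)).const_mul Complex.I
    exact h.scomp u hg
  have h2 : ∀ u : ℝ, HasDerivAt (fun u : ℝ => NormedSpace.exp ((Complex.I * (s - u)) • A))
      ((-Complex.I) • (NormedSpace.exp ((Complex.I * (s - u)) • A) * A)) u := by
    intro u
    have h := hasDerivAt_exp_smul_const (𝕂 := ℂ) A (Complex.I * (s - u))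
    have hg : HasDerivAt (fun u : ℝ => Complex.I * ((s : ℂ) - (u : ℂ))) (-Complex.I) u := by
      simpa using ((Complex.ofRealCLM.hasDerivAt (x := u)).const_sub (s : ℂ)).const_mul Complex.I
    exact h.scomp u hg
  have h3 : ∀ u : ℝ, HasDerivAt (fun u : ℝ => NormedSpace.exp ((Complex.I * (s - u)) • A) * B
      * NormedSpace.exp ((Complex.I * u) • A))
      (Complex.I • (NormedSpace.exp ((Complex.I * (s - u)) • A) * (B * A - A * B)
          * NormedSpace.exp ((Complex.I * u) • A))) u := by
    intro u
    have h := ((h2 u).mul_const B).mul (h1 u)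
    refine h.congr_deriv ?_
    simp only [mul_sub, sub_mul, smul_sub, neg_smul, neg_mul, smul_mul_assoc, mul_smul_comm,
      mul_assoc]
    abel
  have c1 : Continuous (fun u : ℝ => NormedSpace.exp ((Complex.I * u) • A)) :=
    continuous_iff_continuousAt.2 fun u => (h1 u).continuousAt
  have c2 : Continuous (fun u : ℝ => NormedSpace.exp ((Complex.I * (s - u)) • A)) :=
    continuous_iff_continuousAt.2 fun u => (h2 u).continuousAt
  rw [← intervalIntegral.integral_smul,
    intervalIntegral.integral_eq_sub_of_hasDerivAt (fun u _ => h3 u)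
      ((((c2.mul continuous_const).mul c1).const_smul Complex.I).intervalIntegrable _ _)]
  simp
end

section
/- Let H be a complex Hilbert space, let A be a bounded self-adjoint operator on H, let B be a bounded operator on H, let n ≥ 1 be a natural number, and let s be a real number. Then ‖exp(−isA)·B·exp(isA) − Σ_{k=0}^{n−1} ((is)^k / k!) · ad_A^(k)(B)‖ ≤ (|s|^n / n!) · ‖ad_A^(n)(B)‖, where the norm is the operator norm. -/
open scoped Complex

/-- Iterated commutator: `ad_A^(0)(B) = B`, `ad_A^(k)(B) = [ad_A^(k-1)(B), A]`. -/
def adIter {H : Type*} [NormedAddCommGroup H] [InnerProductSpace ℂ H] [CompleteSpace H]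
    (A B : H →L[ℂ] H) : ℕ → (H →L[ℂ] H)
  | 0 => B
  | k + 1 => adIter A B k * A - A * adIter A B k

lemma adIter_shift {H : Type*} [NormedAddCommGroup H] [InnerProductSpace ℂ H] [CompleteSpace H]
    (A B : H →L[ℂ] H) (k : ℕ) : adIter A (B * A - A * B) k = adIter A B (k + 1) := by
  induction k with
  | zero => rfl
  | succ k ih => rw [adIter, ih]; rfl

lemma adIter_neg {H : Type*} [NormedAddCommGroup H] [InnerProductSpace ℂ H] [CompleteSpace H]
    (A B : H →L[ℂ] H) (k : ℕ) : adIter (-A) B k = (-1 : ℂ) ^ k • adIter A B k := by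
  induction k with
  | zero => simp [adIter]
  | succ k ih =>
    rw [adIter, ih, adIter, pow_succ, mul_smul, smul_comm, neg_one_smul]
    simp only [mul_neg, neg_mul, smul_mul_assoc, mul_smul_comm, smul_sub]
    simp only [neg_smul, one_smul, neg_sub, smul_sub, smul_neg]
    abel

lemma norm_exp_le {H : Type*} [NormedAddCommGroup H] [InnerProductSpace ℂ H] [CompleteSpace H]
    (A : H →L[ℂ] H) (hA : IsSelfAdjoint A) (s : ℝ) :
    ‖NormedSpace.exp ((Complex.I * s) • A)‖ ≤ 1 := by
  have h := (selfAdjoint.expUnitary (⟨s • A, (IsSelfAdjoint.all s).smul hA⟩ :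
    selfAdjoint (H →L[ℂ] H))).2
  rw [selfAdjoint.expUnitary_coe] at h
  have e : (Complex.I * s) • A = Complex.I • (s • A) := by
    rw [mul_smul]; rfl
  rw [e]
  rcases subsingleton_or_nontrivial (H →L[ℂ] H) with hH | hH
  · rw [Subsingleton.elim (NormedSpace.exp (Complex.I • (s • A))) 0, norm_zero]
    exact zero_le_one
  · exact (CStarRing.norm_of_mem_unitary h).le

lemma norm_conj_le {H : Type*} [NormedAddCommGroup H] [InnerProductSpace ℂ H] [CompleteSpace H]
    (A B : H →L[ℂ] H) (hA : IsSelfAdjoint A) (s : ℝ) :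
    ‖NormedSpace.exp ((-(Complex.I * s)) • A) * B * NormedSpace.exp ((Complex.I * s) • A)‖
      ≤ ‖B‖ := by
  have h1 := norm_exp_le A hA s
  have h2 := norm_exp_le A hA (-s)
  rw [show Complex.I * ((-s : ℝ) : ℂ) = -(Complex.I * s) by push_cast; ring] at h2
  calc _ ≤ ‖NormedSpace.exp ((-(Complex.I * s)) • A)‖ * ‖B‖
        * ‖NormedSpace.exp ((Complex.I * s) • A)‖ := norm_mul₃_le
    _ ≤ 1 * ‖B‖ * 1 := by gcongr
    _ = _ := by ring

lemma hasDerivAt_conj {H : Type*} [NormedAddCommGroup H] [InnerProductSpace ℂ H]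
    [CompleteSpace H] (A B : H →L[ℂ] H) (s : ℝ) :
    HasDerivAt (fun t : ℝ => NormedSpace.exp ((-(Complex.I * t)) • A) * B *
        NormedSpace.exp ((Complex.I * t) • A))
      (Complex.I • (NormedSpace.exp ((-(Complex.I * s)) • A) * (B * A - A * B) *
        NormedSpace.exp ((Complex.I * s) • A))) s := by
  have l : HasDerivAt (fun t : ℝ => Complex.I * (t : ℂ)) Complex.I s := by
    simpa using (Complex.ofRealCLM.hasDerivAt (x := s)).const_mul Complex.I
  have h1 := (hasDerivAt_exp_smul_const' (𝕂 := ℂ) A (Complex.I * s)).scomp s l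
  have h2 := (hasDerivAt_exp_smul_const (𝕂 := ℂ) A (-(Complex.I * s))).scomp s l.neg
  have h := (h2.mul_const B).mul h1
  refine h.congr_deriv ?_
  simp only [Function.comp_apply, Pi.neg_apply, smul_mul_assoc, mul_smul_comm, mul_sub, sub_mul, smul_sub,
    neg_smul, mul_assoc, neg_mul]
  abel

lemma bound_nonneg {H : Type*} [NormedAddCommGroup H] [InnerProductSpace ℂ H] [CompleteSpace H]
    (A : H →L[ℂ] H) (hA : IsSelfAdjoint A) (n : ℕ) : ∀ (B : H →L[ℂ] H) (s : ℝ), 0 ≤ s →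
    ‖NormedSpace.exp ((-(Complex.I * s)) • A) * B * NormedSpace.exp ((Complex.I * s) • A)
        - ∑ k ∈ Finset.range n, (((Complex.I * s) ^ k) / (k.factorial : ℂ)) • adIter A B k‖
      ≤ (s ^ n / (n.factorial : ℝ)) * ‖adIter A B n‖ := by
  induction n with
  | zero => intro B s _; simpa [adIter] using norm_conj_le A B hA s
  | succ n ih =>
    intro B s hs
    have hd : ∀ t : ℝ, HasDerivAt (fun t : ℝ =>
        NormedSpace.exp ((-(Complex.I * t)) • A) * B * NormedSpace.exp ((Complex.I * t) • A)
        - ∑ k ∈ Finset.range (n + 1),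
          (((Complex.I * t) ^ k) / (k.factorial : ℂ)) • adIter A B k)
        (Complex.I • (NormedSpace.exp ((-(Complex.I * t)) • A) * (B * A - A * B) *
            NormedSpace.exp ((Complex.I * t) • A)
          - ∑ k ∈ Finset.range n, (((Complex.I * t) ^ k) / (k.factorial : ℂ)) •
            adIter A (B * A - A * B) k)) t := by
      intro t
      have l : HasDerivAt (fun t : ℝ => Complex.I * (t : ℂ)) Complex.I t := by
        simpa using (Complex.ofRealCLM.hasDerivAt (x := t)).const_mul Complex.I
      rw [smul_sub]
      refine (hasDerivAt_conj A B t).sub ?_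
      simp only [Finset.sum_range_succ']
      simp only [pow_zero, Finset.smul_sum]
      refine HasDerivAt.add_const _ ?_
      refine HasDerivAt.fun_sum fun k _ => ?_
      rw [adIter_shift, ← mul_smul]
      refine HasDerivAt.smul_const ?_ _
      refine ((l.pow (k + 1)).div_const _).congr_deriv ?_
      have : (k.factorial : ℂ) ≠ 0 := by exact_mod_cast k.factorial_ne_zero
      have : (k : ℂ) + 1 ≠ 0 := by exact_mod_cast k.succ_ne_zero
      rw [Nat.factorial_succ]
      push_cast
      try simp only [Nat.add_sub_cancel]
      field_simp
    have hB : ∀ t : ℝ, HasDerivAt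
        (fun t : ℝ => (t ^ (n + 1) / ((n + 1).factorial : ℝ)) * ‖adIter A B (n + 1)‖)
        ((t ^ n / (n.factorial : ℝ)) * ‖adIter A B (n + 1)‖) t := by
      intro t
      refine HasDerivAt.mul_const ?_ _
      refine ((hasDerivAt_pow (n + 1) t).div_const _).congr_deriv ?_
      have : (n.factorial : ℝ) ≠ 0 := by exact_mod_cast n.factorial_ne_zero
      have : (n : ℝ) + 1 ≠ 0 := by exact_mod_cast n.succ_ne_zero
      rw [Nat.factorial_succ]
      push_cast
      try simp only [Nat.add_sub_cancel]
      field_simp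
    refine image_norm_le_of_norm_deriv_right_le_deriv_boundary (a := 0) (b := s)
      (fun t _ => (hd t).continuousAt.continuousWithinAt)
      (fun t _ => (hd t).hasDerivWithinAt) ?_ hB ?_ (Set.right_mem_Icc.2 hs)
    · simp [Finset.sum_range_succ', adIter]
    · intro t ht
      rw [norm_smul, Complex.norm_I, one_mul, ← adIter_shift]
      exact ih _ t ht.1

/-- For `A` bounded self-adjoint, `B` bounded, `n ≥ 1`, `s : ℝ`:
`‖exp(-isA) B exp(isA) - Σ_{k=0}^{n-1} ((is)^k / k!) • ad_A^(k)(B)‖ ≤ (|s|^n / n!) ‖ad_A^(n)(B)‖`. -/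
theorem conj_exp_taylor_bound
    {H : Type*} [NormedAddCommGroup H] [InnerProductSpace ℂ H] [CompleteSpace H]
    (A B : H →L[ℂ] H) (hA : IsSelfAdjoint A) (n : ℕ) (hn : 1 ≤ n) (s : ℝ) :
    ‖NormedSpace.exp ((-(Complex.I * s)) • A) * B * NormedSpace.exp ((Complex.I * s) • A)
        - ∑ k ∈ Finset.range n, (((Complex.I * s) ^ k) / (k.factorial : ℂ)) • adIter A B k‖
      ≤ (|s| ^ n / (n.factorial : ℝ)) * ‖adIter A B n‖ := by
  rcases le_total 0 s with hs | hs
  · rw [abs_of_nonneg hs]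
    exact bound_nonneg A hA n B s hs
  · have h := bound_nonneg (-A) hA.neg n B (-s) (neg_nonneg.2 hs)
    rw [abs_of_nonpos hs]
    simp only [adIter_neg, norm_smul, norm_pow, norm_neg, norm_one, one_pow, one_mul] at h
    convert h using 3
    · simp
    · refine Finset.sum_congr rfl fun k _ => ?_
      rw [← mul_smul, div_mul_eq_mul_div, ← mul_pow]
      simp
end

section
/- Let H be a complex Hilbert space, let A be a bounded self-adjoint operator on H, let B be a bounded operator on H, and let g : ℝ → ℂ be measurable with ∫_ℝ |g(s)| ds < ∞ and ∫_ℝ |g(s)| |s| ds < ∞. With f_g(A) := ∫_ℝ g(s) exp(isA) ds, one has the operator-norm bound ‖[B, f_g(A)]‖ ≤ ‖[B,A]‖ · ∫_ℝ |g(s)| |s| ds. -/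
open scoped Complex
open MeasureTheory

lemma aux_norm_le {H : Type*} [NormedAddCommGroup H] [InnerProductSpace ℂ H] [CompleteSpace H]
    (A : H →L[ℂ] H) (hA : IsSelfAdjoint A) (s : ℝ) :
    ‖NormedSpace.exp (s • (Complex.I • A))‖ ≤ 1 := by
  have hsa : IsSelfAdjoint (s • A) := by
    rw [isSelfAdjoint_iff, star_smul, hA.star_eq, star_trivial]
  have hu := (selfAdjoint.expUnitary (⟨s • A, hsa⟩ : selfAdjoint (H →L[ℂ] H))).2
  rw [selfAdjoint.expUnitary_coe] at hu
  have e : Complex.I • (s • A) = s • (Complex.I • A) := smul_comm _ _ _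
  simp only [e] at hu
  set U := NormedSpace.exp (s • (Complex.I • A))
  have h1 : star U * U = 1 := (Unitary.mem_iff.1 hu).1
  have h2 : ‖star U * U‖ = ‖U‖ * ‖U‖ := CStarRing.norm_star_mul_self
  have h3 : ‖(1 : H →L[ℂ] H)‖ ≤ 1 := ContinuousLinearMap.norm_id_le
  rw [h1] at h2
  nlinarith [norm_nonneg U]

lemma aux_comm {H : Type*} [NormedAddCommGroup H] [InnerProductSpace ℂ H] [CompleteSpace H]
    (A B : H →L[ℂ] H) (hA : IsSelfAdjoint A) (s : ℝ) :
    ‖B * NormedSpace.exp (s • (Complex.I • A)) - NormedSpace.exp (s • (Complex.I • A)) * B‖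
      ≤ ‖B * A - A * B‖ * |s| := by
  set X := Complex.I • A with hX
  let U : ℝ → (H →L[ℂ] H) := fun t => NormedSpace.exp (t • X)
  have hU : ∀ t, ‖U t‖ ≤ 1 := aux_norm_le A hA
  have hUd : ∀ t, HasDerivAt U (U t * X) t := fun t => hasDerivAt_exp_smul_const X t
  have hUd' : ∀ t, HasDerivAt U (X * U t) t := fun t => hasDerivAt_exp_smul_const' X t
  have hVd : ∀ t, HasDerivAt (fun t => U (-t)) (-(X * U (-t))) t := fun t => by
    have := (hUd' (-t)).scomp t (hasDerivAt_neg t)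
    simpa [Function.comp_def] using this
  have hinv : ∀ t, U (-t) * U t = 1 := fun t => by
    simp only [U, neg_smul]
    letI : NormedAlgebra ℚ (H →L[ℂ] H) := NormedAlgebra.restrictScalars ℚ ℂ _
    rw [← NormedSpace.exp_add_of_commute, neg_add_cancel, NormedSpace.exp_zero]
    exact (Commute.refl _).neg_left
  have hd : ∀ t, HasDerivAt (fun t => U t * B * U (-t)) (U t * (X * B - B * X) * U (-t)) t := by
    intro t
    have h := ((hUd t).mul_const B).mul (hVd t)
    have e : U t * (X * B - B * X) * U (-t)
        = U t * X * B * U (-t) + U t * B * -(X * U (-t)) := by noncomm_ring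
    rw [e]
    exact h
  have hXB : ‖X * B - B * X‖ = ‖B * A - A * B‖ := by
    rw [hX, smul_mul_assoc, mul_smul_comm, ← smul_sub, norm_smul, norm_sub_rev]
    simp
  have hb : ∀ t, ‖U t * (X * B - B * X) * U (-t)‖ ≤ ‖B * A - A * B‖ := by
    intro t
    rw [← hXB]
    calc _ ≤ ‖U t‖ * ‖X * B - B * X‖ * ‖U (-t)‖ := norm_mul₃_le
      _ ≤ 1 * ‖X * B - B * X‖ * 1 := by
        gcongr
        exacts [hU t, hU _]
      _ = _ := by ring
  have hm := Convex.norm_image_sub_le_of_norm_hasDerivWithin_le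
    (fun t _ => (hd t).hasDerivWithinAt) (fun t _ => hb t) convex_univ
    (Set.mem_univ (0 : ℝ)) (Set.mem_univ s)
  have hU0 : U 0 = 1 := by simp [U]
  simp only [neg_zero, hU0, one_mul, mul_one, sub_zero, Real.norm_eq_abs] at hm
  change ‖B * U s - U s * B‖ ≤ _
  have e : B * U s - U s * B = -((U s * B * U (-s) - B) * U s) := by
    rw [sub_mul, mul_assoc _ _ (U s), hinv, mul_one]; abel
  rw [e, norm_neg]
  calc _ ≤ ‖U s * B * U (-s) - B‖ * ‖U s‖ := norm_mul_le _ _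
    _ ≤ ‖U s * B * U (-s) - B‖ * 1 := by gcongr; exact hU s
    _ ≤ _ := by rw [mul_one]; exact hm

/-- For `A` bounded self-adjoint, `B` bounded, and `g : ℝ → ℂ` measurable with
`∫ |g| < ∞` and `∫ |g(s)||s| ds < ∞`, setting `f_g(A) = ∫ g(s) exp(isA) ds`, one has
`‖[B, f_g(A)]‖ ≤ ‖[B,A]‖ · ∫ |g(s)||s| ds`. -/
theorem norm_commutator_smoothFn_le
    {H : Type*} [NormedAddCommGroup H] [InnerProductSpace ℂ H] [CompleteSpace H]
    (A B : H →L[ℂ] H) (hA : IsSelfAdjoint A) (g : ℝ → ℂ) (hmeas : Measurable g)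
    (hg0 : Integrable g) (hg1 : Integrable (fun s : ℝ => ‖g s‖ * |s|)) :
    ‖B * (∫ s : ℝ, g s • NormedSpace.exp ((Complex.I * s) • A))
        - (∫ s : ℝ, g s • NormedSpace.exp ((Complex.I * s) • A)) * B‖
      ≤ ‖B * A - A * B‖ * ∫ s : ℝ, ‖g s‖ * |s| := by
  have e : ∀ s : ℝ, (Complex.I * s) • A = s • (Complex.I • A) := fun s => by
    rw [mul_comm, mul_smul, Complex.coe_smul]
  simp only [e]
  have hc : Continuous fun s : ℝ => NormedSpace.exp (s • (Complex.I • A)) :=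
    continuous_iff_continuousAt.2 fun t =>
      (hasDerivAt_exp_smul_const (𝕂 := ℝ) (Complex.I • A) t).continuousAt
  have hF : Integrable fun s : ℝ => g s • NormedSpace.exp (s • (Complex.I • A)) := by
    refine hg0.norm.mono' (hg0.1.smul hc.aestronglyMeasurable) (ae_of_all _ fun s => ?_)
    rw [norm_smul]
    exact mul_le_of_le_one_right (norm_nonneg _) (aux_norm_le A hA s)
  rw [← integral_const_mul_of_integrable hF, ← integral_mul_const_of_integrable hF,
    ← integral_sub (hF.const_mul B) (hF.mul_const B), ← integral_const_mul]
  refine norm_integral_le_of_norm_le (hg1.const_mul _) (ae_of_all _ fun s => ?_)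
  rw [mul_smul_comm, smul_mul_assoc, ← smul_sub, norm_smul]
  calc _ ≤ ‖g s‖ * (‖B * A - A * B‖ * |s|) := by gcongr; exact aux_comm A B hA s
    _ = _ := by ring
end

section
/- Let H be a complex Hilbert space and let A be a bounded self-adjoint operator on H. Let f : ℝ → ℂ be a Schwartz function. Then the continuous functional calculus of A applied to f satisfies f(A) = ∫_ℝ (𝓕f)(ξ) · exp(2πiξA) dξ, where 𝓕f(ξ) = ∫_ℝ f(λ) e^{−2πiλξ} dλ is the Fourier transform and the right-hand side is a Bochner integral in the space of bounded operators on H. -/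
open scoped Complex FourierTransform
open MeasureTheory

/-- For a bounded self-adjoint operator `A` on a complex Hilbert space and a
Schwartz function `f : ℝ → ℂ`, the continuous functional calculus of `A` applied to `f`
(i.e. to `z ↦ f (Re z)`, which restricts to `f` on the real spectrum of `A`) satisfies
`f(A) = ∫ (𝓕f)(ξ) exp(2πiξA) dξ`. -/
theorem cfc_eq_fourier_integral_exp
    {H : Type*} [NormedAddCommGroup H] [InnerProductSpace ℂ H] [CompleteSpace H]
    (A : H →L[ℂ] H) (hA : IsSelfAdjoint A) (f : SchwartzMap ℝ ℂ) :
    cfc (fun z : ℂ => f z.re) A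
      = ∫ ξ : ℝ, (𝓕 (⇑f) ξ) •
          NormedSpace.exp (((2 * (Real.pi : ℂ) * (ξ : ℂ)) * Complex.I) • A) := by
  have hn : IsStarNormal A := hA.isStarNormal
  have hF : (𝓕 (⇑f) : ℝ → ℂ) = ⇑(𝓕 f : SchwartzMap ℝ ℂ) := (SchwartzMap.fourier_coe f).symm
  have hcont : Continuous (𝓕 (⇑f) : ℝ → ℂ) := by rw [hF]; exact (𝓕 f : SchwartzMap ℝ ℂ).continuous
  have hint : Integrable (𝓕 (⇑f) : ℝ → ℂ) := by rw [hF]; exact (𝓕 f : SchwartzMap ℝ ℂ).integrable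
  have hre : ∀ z ∈ spectrum ℂ A, z = (z.re : ℂ) := fun z hz => hA.mem_spectrum_eq_re hz
  have h1 : ∀ ξ : ℝ, (𝓕 (⇑f) ξ) •
      NormedSpace.exp (((2 * (Real.pi : ℂ) * (ξ : ℂ)) * Complex.I) • A)
      = cfc (fun z : ℂ => 𝓕 (⇑f) ξ * Complex.exp ((2 * (Real.pi : ℂ) * (ξ : ℂ)) * Complex.I * z)) A := by
    intro ξ
    have hn' : IsStarNormal (((2 * (Real.pi : ℂ) * (ξ : ℂ)) * Complex.I) • A) := by
      infer_instance
    rw [cfc_const_mul _ _ A (by fun_prop), ← CFC.complex_exp_eq_normedSpace_exp hn',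
      ← cfc_comp_smul _ _ A (by fun_prop)]
    simp only [smul_eq_mul]
  simp_rw [h1]
  rw [← cfc_integral _ (fun ξ => ‖𝓕 (⇑f) ξ‖) A _ _ hint.norm.2]
  · refine cfc_congr fun z hz => ?_
    have hinv := congrFun (f.continuous.fourierInv_fourier_eq f.integrable hint) z.re
    beta_reduce
    rw [← hinv, Real.fourierInv_eq']
    refine integral_congr_ae (.of_forall fun ξ => ?_)
    simp only [smul_eq_mul]
    rw [mul_comm]
    congr 2
    conv_rhs => rw [hre z hz]
    simp
    ring
  · refine Continuous.continuousOn ?_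
    simp only [Function.uncurry_def]
    fun_prop
  · refine .of_forall fun ξ z hz => ?_
    rw [hre z hz, norm_mul]
    have : (2 * (Real.pi : ℂ) * (ξ : ℂ)) * Complex.I * (z.re : ℂ) = ((2 * Real.pi * ξ * z.re : ℝ) : ℂ) * Complex.I := by
      push_cast; ring
    rw [this, Complex.norm_exp_ofReal_mul_I, mul_one]
end

section
/- There is a constant C > 0 such that for every continuously differentiable, compactly supported function u : ℝ³ → ℂ that is radial (i.e. u(x) = u(y) whenever ‖x‖ = ‖y‖), and for every x ∈ ℝ³ with x ≠ 0, one has ‖x‖^{1/2} · |u(x)| ≤ C · ‖∇u‖_{L²(ℝ³)}, where ‖∇u‖_{L²(ℝ³)} = ( ∫_{ℝ³} ‖Du(x)‖² dx )^{1/2} and Du(x) denotes the (Fréchet) derivative of u at x. -/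
open MeasureTheory

/-- One-dimensional weighted estimate. -/
theorem strauss_one_dim (g : ℝ → ℂ) (hg : ContDiff ℝ 1 g) (hc : HasCompactSupport g)
    (R : ℝ) (hR : 0 < R) :
    R * ‖g R‖ ^ 2 ≤ ∫ r in Set.Ioi (0 : ℝ), r ^ 2 * ‖deriv g r‖ ^ 2 := by
  set A := ∫ r in Set.Ioi (0 : ℝ), r ^ 2 * ‖deriv g r‖ ^ 2 with hA
  have hdc : Continuous (deriv g) := hg.continuous_deriv le_rfl
  have hds : HasCompactSupport (deriv g) := hc.deriv
  have hint : Integrable (fun r : ℝ => r ^ 2 * ‖deriv g r‖ ^ 2) := by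
    apply Continuous.integrable_of_hasCompactSupport (by fun_prop)
    apply hds.mono
    intro r hr h
    exact hr (by simp [Function.notMem_support.mp (fun h' => h' h)])
  have hA0 : 0 ≤ A := setIntegral_nonneg measurableSet_Ioi (fun r _ => by positivity)
  by_cases h0 : g R = 0
  · simpa [h0] using hA0
  have ha : 0 < ‖g R‖ := norm_pos_iff.mpr h0
  set a := ‖g R‖ with haeq
  have h1 : a ≤ ∫ r in Set.Ioi R, ‖deriv g r‖ := by
    have := hc.integral_Ioi_deriv_eq hg R
    calc a = ‖∫ r in Set.Ioi R, deriv g r‖ := by rw [this, norm_neg]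
      _ ≤ _ := norm_integral_le_integral_norm _
  have hp : IntegrableOn (fun r : ℝ => r ^ (-2 : ℝ)) (Set.Ioi R) :=
    integrableOn_Ioi_rpow_of_lt (by norm_num) hR
  have hpv : ∫ r in Set.Ioi R, r ^ (-2 : ℝ) = R⁻¹ := by
    rw [integral_Ioi_rpow_of_lt (by norm_num) hR]
    norm_num [Real.rpow_neg_one]
  have h2 : ∫ r in Set.Ioi R, ‖deriv g r‖ ≤
      ∫ r in Set.Ioi R, (R * a / 2 * r ^ (-2 : ℝ)
        + 1 / (2 * (R * a)) * (r ^ 2 * ‖deriv g r‖ ^ 2)) := by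
    apply setIntegral_mono_on
    · exact (hdc.integrable_of_hasCompactSupport hds).norm.integrableOn
    · exact (hp.const_mul _).add (hint.integrableOn.const_mul _)
    · exact measurableSet_Ioi
    · intro r hr
      have hr0 : 0 < r := hR.trans hr
      have e : r ^ (-2 : ℝ) = (r ^ 2)⁻¹ := by
        rw [Real.rpow_neg hr0.le]; norm_num
      rw [e]
      have ht : 0 < R * a := by positivity
      generalize R * a = t at ht
      generalize ‖deriv g r‖ = d
      have : t / 2 * (r ^ 2)⁻¹ + 1 / (2 * t) * (r ^ 2 * d ^ 2) - d
          = (t - r ^ 2 * d) ^ 2 / (2 * t * r ^ 2) := by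
        field_simp
        ring
      have h' : 0 ≤ (t - r ^ 2 * d) ^ 2 / (2 * t * r ^ 2) := by positivity
      linarith
  rw [integral_add (hp.const_mul _) (hint.integrableOn.const_mul _), integral_const_mul,
    integral_const_mul, hpv] at h2
  have h3 : ∫ r in Set.Ioi R, r ^ 2 * ‖deriv g r‖ ^ 2 ≤ A := by
    apply setIntegral_mono_set hint.integrableOn
    · exact Filter.Eventually.of_forall (fun r => by positivity)
    · exact (Set.Ioi_subset_Ioi hR.le).eventuallyLE
  have h4 : a ≤ R * a / 2 * R⁻¹ + 1 / (2 * (R * a)) * A :=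
    (h1.trans h2).trans (by gcongr)
  have h5 : R * a / 2 * R⁻¹ + 1 / (2 * (R * a)) * A = a / 2 + A / (2 * (R * a)) := by
    field_simp
  rw [h5] at h4
  have h6 : a / 2 ≤ A / (2 * (R * a)) := by linarith
  rw [le_div_iff₀ (by positivity)] at h6
  nlinarith

/-- homogeneous radial Sobolev / Strauss embedding in `ℝ³`.
There is `C > 0` such that for every `C¹`, compactly supported, radial `u : ℝ³ → ℂ` and every
`x ≠ 0`, `‖x‖^{1/2} |u(x)| ≤ C ‖∇u‖_{L²(ℝ³)}`. -/
theorem radial_sobolev_homogeneous :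
    ∃ C : ℝ, 0 < C ∧
      ∀ u : EuclideanSpace ℝ (Fin 3) → ℂ,
        ContDiff ℝ 1 u → HasCompactSupport u →
        (∀ x y : EuclideanSpace ℝ (Fin 3), ‖x‖ = ‖y‖ → u x = u y) →
        ∀ x : EuclideanSpace ℝ (Fin 3), x ≠ 0 →
          ‖x‖ ^ ((1 : ℝ) / 2) * ‖u x‖
            ≤ C * (∫ y : EuclideanSpace ℝ (Fin 3), ‖fderiv ℝ u y‖ ^ 2) ^ ((1 : ℝ) / 2) := by
  set κ : ℝ := 3 * (volume : Measure (EuclideanSpace ℝ (Fin 3))).real (Metric.ball 0 1) with hκ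
  have hκ0 : 0 < κ := by
    have : 0 < (volume : Measure (EuclideanSpace ℝ (Fin 3))).real (Metric.ball 0 1) :=
      ENNReal.toReal_pos (Metric.measure_ball_pos _ _ one_pos).ne' measure_ball_lt_top.ne
    positivity
  refine ⟨(κ⁻¹) ^ ((1 : ℝ) / 2), by positivity, ?_⟩
  intro u hu hc hrad x hx
  obtain ⟨e, he⟩ : ∃ e : EuclideanSpace ℝ (Fin 3), ‖e‖ = 1 := exists_norm_eq _ zero_le_one
  set g : ℝ → ℂ := fun r => u (r • e) with hgdef
  have hg : ContDiff ℝ 1 g := hu.comp (by fun_prop)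
  have hemb : Topology.IsClosedEmbedding (fun r : ℝ => r • e) :=
    isClosedEmbedding_smul_left (by rintro rfl; simp at he)
  have hgc : HasCompactSupport g := hc.comp_isClosedEmbedding hemb
  have hgw : ∀ w : EuclideanSpace ℝ (Fin 3), ‖w‖ = 1 → ∀ r : ℝ, g r = u (r • w) := by
    intro w hw r
    exact hrad _ _ (by simp [norm_smul, he, hw])
  have hbound : ∀ y : EuclideanSpace ℝ (Fin 3), ‖deriv g ‖y‖‖ ≤ ‖fderiv ℝ u y‖ := by
    intro y
    obtain ⟨w, hw, hy⟩ : ∃ w : EuclideanSpace ℝ (Fin 3), ‖w‖ = 1 ∧ ‖y‖ • w = y := by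
      by_cases h : y = 0
      · exact ⟨e, he, by simp [h]⟩
      · have h' : ‖y‖ ≠ 0 := norm_ne_zero_iff.mpr h
        exact ⟨‖y‖⁻¹ • y, by simp [norm_smul, h'], by rw [smul_smul, mul_inv_cancel₀ h', one_smul]⟩
    have hd : HasDerivAt g (fderiv ℝ u y w) ‖y‖ := by
      have e1 : g = fun r : ℝ => u (r • w) := funext (hgw w hw)
      rw [e1]
      have h1 : HasDerivAt (fun r : ℝ => r • w) w ‖y‖ := by
        simpa using (hasDerivAt_id ‖y‖).smul_const w
      have h2 : HasFDerivAt u (fderiv ℝ u y) (‖y‖ • w) := by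
        rw [hy]
        exact (hu.differentiable one_ne_zero y).hasFDerivAt
      exact h2.comp_hasDerivAt _ h1
    rw [hd.deriv]
    simpa [hw] using (fderiv ℝ u y).le_opNorm w
  have hI : Integrable (fun y : EuclideanSpace ℝ (Fin 3) => ‖fderiv ℝ u y‖ ^ 2) := by
    have hfc := hu.continuous_fderiv one_ne_zero
    apply Continuous.integrable_of_hasCompactSupport (by fun_prop)
    apply (hc.fderiv ℝ).mono
    intro r hr h
    exact hr (by simp [Function.notMem_support.mp (fun h' => h' h)])
  have hle : ∫ y : EuclideanSpace ℝ (Fin 3), ‖deriv g ‖y‖‖ ^ 2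
      ≤ ∫ y : EuclideanSpace ℝ (Fin 3), ‖fderiv ℝ u y‖ ^ 2 := by
    apply integral_mono_of_nonneg
    · exact Filter.Eventually.of_forall (fun y => by positivity)
    · exact hI
    · exact Filter.Eventually.of_forall (fun y => by
        have := hbound y
        dsimp only
        gcongr)
  rw [integral_fun_norm_addHaar volume (fun r : ℝ => ‖deriv g r‖ ^ 2)] at hle
  simp only [finrank_euclideanSpace, Fintype.card_fin, nsmul_eq_mul, smul_eq_mul] at hle
  have hone := strauss_one_dim g hg hgc ‖x‖ (norm_pos_iff.mpr hx)
  have hgx : g ‖x‖ = u x := hrad _ _ (by simp [norm_smul, he])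
  rw [hgx] at hone
  set I := ∫ y : EuclideanSpace ℝ (Fin 3), ‖fderiv ℝ u y‖ ^ 2 with hIdef
  have hI0 : 0 ≤ I := integral_nonneg (fun y => by positivity)
  have hfin : ‖x‖ * ‖u x‖ ^ 2 ≤ κ⁻¹ * I := by
    rw [inv_mul_eq_div, le_div_iff₀ hκ0]
    calc ‖x‖ * ‖u x‖ ^ 2 * κ ≤ (∫ r in Set.Ioi (0 : ℝ), r ^ 2 * ‖deriv g r‖ ^ 2) * κ := by gcongr
      _ ≤ I := by
        refine le_trans (le_of_eq ?_) hle
        norm_num [hκ]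
        ring
  rw [← Real.mul_rpow (by positivity) hI0]
  simp only [← Real.sqrt_eq_rpow]
  apply Real.le_sqrt_of_sq_le
  rw [mul_pow, Real.sq_sqrt (norm_nonneg x)]
  exact hfin
end

section
/- There is a constant C > 0 such that for every continuously differentiable, compactly supported function u : ℝ³ → ℂ that is radial (i.e. u(x) = u(y) whenever ‖x‖ = ‖y‖), and for every x ∈ ℝ³ with ‖x‖ ≥ 1, one has ‖x‖ · |u(x)| ≤ C · ( ‖u‖_{L²(ℝ³)} + ‖∇u‖_{L²(ℝ³)} ), where ‖u‖_{L²(ℝ³)} is the L² norm of u and ‖∇u‖_{L²(ℝ³)} = ( ∫_{ℝ³} ‖Du(x)‖² dx )^{1/2} with Du the Fréchet derivative of u. -/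
open MeasureTheory

theorem radial_aux_one (v : ℝ → ℂ) (hv : ContDiff ℝ 1 v) (hc : HasCompactSupport v) (R : ℝ)
    (hR : 0 < R) :
    R ^ 2 * ‖v R‖ ^ 2 ≤ (∫ r in Set.Ioi (0:ℝ), r ^ 2 * ‖v r‖ ^ 2)
      + ∫ r in Set.Ioi (0:ℝ), r ^ 2 * ‖deriv v r‖ ^ 2 := by
  have hw : ContDiff ℝ 1 (fun r => ‖v r‖ ^ 2) := hv.norm_sq ℝ
  have hwc : HasCompactSupport (fun r => ‖v r‖ ^ 2) :=
    hc.comp_left (g := fun z : ℂ => ‖z‖ ^ 2) (by simp)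
  have hdc : HasCompactSupport (fun r => ‖deriv v r‖ ^ 2) :=
    hc.deriv.comp_left (g := fun z : ℂ => ‖z‖ ^ 2) (by simp)
  have hd : Continuous (deriv v) := hv.continuous_deriv le_rfl
  have hvc : Continuous v := hv.continuous
  have i1 : Integrable (fun r : ℝ => r ^ 2 * ‖v r‖ ^ 2) :=
    Continuous.integrable_of_hasCompactSupport (by fun_prop) hwc.mul_left
  have i2 : Integrable (fun r : ℝ => r ^ 2 * ‖deriv v r‖ ^ 2) :=
    Continuous.integrable_of_hasCompactSupport (by fun_prop) hdc.mul_left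
  have i3 : Integrable (deriv (fun r => ‖v r‖ ^ 2)) :=
    Continuous.integrable_of_hasCompactSupport (hw.continuous_deriv le_rfl) hwc.deriv
  have key := HasCompactSupport.integral_Ioi_deriv_eq hw hwc R
  have hder : ∀ r, |deriv (fun r => ‖v r‖ ^ 2) r| ≤ ‖v r‖ ^ 2 + ‖deriv v r‖ ^ 2 := by
    intro r
    have h := (((hv.differentiable one_ne_zero) r).hasDerivAt.norm_sq).deriv
    rw [h, abs_mul, abs_two]
    have := abs_real_inner_le_norm (v r) (deriv v r)
    nlinarith [sq_nonneg (‖v r‖ - ‖deriv v r‖)]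
  have e : R ^ 2 * ‖v R‖ ^ 2 = ∫ r in Set.Ioi R, -(R ^ 2 * deriv (fun r => ‖v r‖ ^ 2) r) := by
    rw [integral_neg, integral_const_mul, key]; ring
  rw [e, ← integral_add i1.integrableOn i2.integrableOn]
  calc _ ≤ ∫ r in Set.Ioi R, (r ^ 2 * ‖v r‖ ^ 2 + r ^ 2 * ‖deriv v r‖ ^ 2) := by
        apply setIntegral_mono_on (i3.const_mul _).neg.integrableOn (i1.add i2).integrableOn
          measurableSet_Ioi
        intro r hr
        have hr' : R < r := hr
        simp only [Pi.add_apply, Pi.neg_apply]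
        have h1 := (neg_le_abs _).trans (hder r)
        have h2 : R ^ 2 ≤ r ^ 2 := by gcongr
        have h3 : 0 ≤ ‖v r‖ ^ 2 + ‖deriv v r‖ ^ 2 := by positivity
        nlinarith [mul_le_mul_of_nonneg_left h1 (sq_nonneg R), mul_le_mul_of_nonneg_right h2 h3]
    _ ≤ _ := by
        apply setIntegral_mono_set (i1.add i2).integrableOn
        · exact Filter.Eventually.of_forall fun r => by simp only [Pi.zero_apply, Pi.add_apply]; positivity
        · exact (Set.Ioi_subset_Ioi hR.le).eventuallyLE

/-- inhomogeneous radial Sobolev / Strauss embedding in `ℝ³`, region `‖x‖ ≥ 1`.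
There is `C > 0` such that for every `C¹`, compactly supported, radial `u : ℝ³ → ℂ` and every
`x` with `‖x‖ ≥ 1`, `‖x‖ |u(x)| ≤ C (‖u‖_{L²(ℝ³)} + ‖∇u‖_{L²(ℝ³)})`. -/
theorem radial_sobolev_inhomogeneous :
    ∃ C : ℝ, 0 < C ∧
      ∀ u : EuclideanSpace ℝ (Fin 3) → ℂ,
        ContDiff ℝ 1 u → HasCompactSupport u →
        (∀ x y : EuclideanSpace ℝ (Fin 3), ‖x‖ = ‖y‖ → u x = u y) →
        ∀ x : EuclideanSpace ℝ (Fin 3), 1 ≤ ‖x‖ →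
          ‖x‖ * ‖u x‖
            ≤ C * ((∫ y : EuclideanSpace ℝ (Fin 3), ‖u y‖ ^ 2) ^ ((1 : ℝ) / 2)
                + (∫ y : EuclideanSpace ℝ (Fin 3), ‖fderiv ℝ u y‖ ^ 2) ^ ((1 : ℝ) / 2)) := by
  set κ : ℝ := 3 * (volume : Measure (EuclideanSpace ℝ (Fin 3))).real (Metric.ball 0 1) with hκ
  have hκ0 : 0 < κ := by
    have : 0 < (volume : Measure (EuclideanSpace ℝ (Fin 3))).real (Metric.ball 0 1) :=
      ENNReal.toReal_pos (Metric.measure_ball_pos _ _ one_pos).ne' measure_ball_lt_top.ne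
    positivity
  have polar : ∀ f : ℝ → ℝ, ∫ y : EuclideanSpace ℝ (Fin 3), f ‖y‖
      = κ * ∫ r in Set.Ioi (0:ℝ), r ^ 2 * f r := by
    intro f
    rw [integral_fun_norm_addHaar]
    simp [hκ, mul_assoc]
  refine ⟨√(κ⁻¹), by positivity, ?_⟩
  intro u hu huc hrad x hx
  have hx0 : 0 < ‖x‖ := by linarith
  set e : EuclideanSpace ℝ (Fin 3) := ‖x‖⁻¹ • x with he
  have hen : ‖e‖ = 1 := by
    rw [he, norm_smul, norm_inv, norm_norm, inv_mul_cancel₀ hx0.ne']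
  set v : ℝ → ℂ := fun r => u (r • e) with hvdef
  have hv : ContDiff ℝ 1 v := hu.comp (contDiff_id.smul contDiff_const)
  have huv : ∀ y, u y = v ‖y‖ := fun y => hrad _ _ (by simp [norm_smul, hen])
  have hvc : HasCompactSupport v := by
    obtain ⟨M, hM⟩ := huc.isCompact.isBounded.exists_norm_le
    apply HasCompactSupport.of_support_subset_isCompact (isCompact_Icc (a := -M) (b := M))
    intro r hr
    have := hM (r • e) (subset_tsupport _ hr)
    rw [norm_smul, hen, mul_one] at this
    exact abs_le.1 this
  have hdv : ∀ y : EuclideanSpace ℝ (Fin 3), y ≠ 0 → ‖deriv v ‖y‖‖ ≤ ‖fderiv ℝ u y‖ := by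
    intro y hy
    have hy0 : 0 < ‖y‖ := norm_pos_iff.2 hy
    set f : EuclideanSpace ℝ (Fin 3) := ‖y‖⁻¹ • y with hf
    have hfn : ‖f‖ = 1 := by
      rw [hf, norm_smul, norm_inv, norm_norm, inv_mul_cancel₀ hy0.ne']
    have hvf : v = fun r : ℝ => u (r • f) := by
      funext r
      exact hrad _ _ (by simp [norm_smul, hen, hfn])
    have hyf : ‖y‖ • f = y := by rw [hf, smul_inv_smul₀ hy0.ne']
    have h1 : HasDerivAt (fun r : ℝ => r • f) f ‖y‖ := by
      simpa using (hasDerivAt_id ‖y‖).smul_const f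
    have h2 : HasFDerivAt u (fderiv ℝ u y) (‖y‖ • f) := by
      rw [hyf]; exact ((hu.differentiable one_ne_zero) y).hasFDerivAt
    have h3 : HasDerivAt v (fderiv ℝ u y f) ‖y‖ := by
      rw [hvf]; exact h2.comp_hasDerivAt _ h1
    rw [h3.deriv]
    simpa [hfn] using (fderiv ℝ u y).le_opNorm f
  have main := radial_aux_one v hv hvc ‖x‖ hx0
  have pA := polar (fun r => ‖v r‖ ^ 2)
  have pB := polar (fun r => ‖deriv v r‖ ^ 2)
  simp only [← huv] at pA main
  have hdu : Continuous (fderiv ℝ u) := hu.continuous_fderiv one_ne_zero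
  have iB : Integrable (fun y => ‖fderiv ℝ u y‖ ^ 2) :=
    Continuous.integrable_of_hasCompactSupport (by fun_prop)
      ((huc.fderiv ℝ).comp_left (g := fun z => ‖z‖ ^ 2) (by simp))
  have hB : ∫ y : EuclideanSpace ℝ (Fin 3), ‖deriv v ‖y‖‖ ^ 2 ≤ ∫ y, ‖fderiv ℝ u y‖ ^ 2 := by
    apply integral_mono_of_nonneg (Filter.Eventually.of_forall fun y => by positivity) iB
    filter_upwards [compl_mem_ae_iff.2 (measure_singleton (0 : EuclideanSpace ℝ (Fin 3)))] with y hy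
    have := hdv y hy
    gcongr
  set A := ∫ y : EuclideanSpace ℝ (Fin 3), ‖u y‖ ^ 2 with hA
  set B := ∫ y : EuclideanSpace ℝ (Fin 3), ‖fderiv ℝ u y‖ ^ 2 with hBd
  have hA0 : 0 ≤ A := integral_nonneg fun y => by positivity
  have hB0 : 0 ≤ B := integral_nonneg fun y => by positivity
  have tot : (‖x‖ * ‖u x‖) ^ 2 ≤ κ⁻¹ * (A + B) := by
    rw [mul_pow, le_inv_mul_iff₀ hκ0]
    nlinarith [mul_le_mul_of_nonneg_left main hκ0.le]
  rw [← Real.sqrt_eq_rpow, ← Real.sqrt_eq_rpow]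
  apply le_of_sq_le_sq _ (by positivity)
  refine tot.trans ?_
  rw [mul_pow, Real.sq_sqrt (by positivity)]
  gcongr
  nlinarith [Real.sq_sqrt hA0, Real.sq_sqrt hB0, Real.sqrt_nonneg A, Real.sqrt_nonneg B,
    mul_nonneg (Real.sqrt_nonneg A) (Real.sqrt_nonneg B)]
end

section
/- Let V : ℝ³ → ℝ be smooth with V and all its partial derivatives bounded, and let ψ : ℝ × ℝ³ → ℂ be smooth such that for every t ∈ ℝ the function x ↦ ψ(t,x) is a Schwartz function, t ↦ ψ(t,·) is a smooth curve in Schwartz space, and ψ solves the Schrödinger equation i ∂_t ψ(t,x) = −Δψ(t,x) + V(x) ψ(t,x) for all (t,x). Then the function t ↦ ∫_{ℝ³} ‖x‖² |ψ(t,x)|² dx is differentiable and its derivative equals 4 · Im ∫_{ℝ³} conj(ψ(t,x)) · (x · ∇ψ(t,x)) dx for every t, where x · ∇ψ = Σ_{j=1}^{3} x_j ∂_{x_j} ψ. -/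
open MeasureTheory
open scoped ContDiff


namespace Dil
open Filter Topology
open scoped LineDeriv

abbrev E3 := EuclideanSpace ℝ (Fin 3)
abbrev S3 := SchwartzMap E3 ℂ

noncomputable def ee (j : Fin 3) : E3 := EuclideanSpace.single j (1 : ℝ)

noncomputable def Dj (j : Fin 3) : S3 →L[ℝ] S3 := LineDeriv.lineDerivOpCLM ℝ S3 (ee j)

lemma Dj_apply (j : Fin 3) (φ : S3) (x : E3) : Dj j φ x = fderiv ℝ φ x (ee j) := rfl

lemma Dj_eq (j : Fin 3) (φ : S3) : Dj j φ = ∂_{ee j} φ := rfl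

lemma DDj_apply (j : Fin 3) (φ : S3) (x : E3) :
    Dj j (Dj j φ) x = fderiv ℝ (fderiv ℝ φ) x (ee j) (ee j) := by
  rw [Dj_apply]
  have h1 : (Dj j φ : E3 → ℂ) = fun y => fderiv ℝ φ y (ee j) := by
    ext y; exact Dj_apply j φ y
  rw [h1]
  have hd : DifferentiableAt ℝ (fderiv ℝ φ) x := by
    have := (φ.smooth 2).fderiv_right (m := 1) (by norm_num)
    exact this.differentiable (by norm_num) x
  rw [fderiv_clm_apply hd (by fun_prop)]
  simp

noncomputable def q (φ : S3) : ℝ := ∫ x, ‖φ x‖ ^ 2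

lemma q_nonneg (φ : S3) : 0 ≤ q φ := integral_nonneg fun x => by positivity

lemma int_base (φ ψ : S3) : Integrable (fun x : E3 => (1 + ‖x‖ ^ 2) * (‖φ x‖ * ‖ψ x‖)) := by
  obtain ⟨C, hC⟩ := ψ.decay 0 0
  have hC' : ∀ x, ‖ψ x‖ ≤ C := fun x => by simpa using hC.2 x
  have h0 := φ.integrable_pow_mul (volume : Measure E3) 0
  have h2 := φ.integrable_pow_mul (volume : Measure E3) 2
  refine ((h0.add h2).mul_const C).mono' (by fun_prop) (Eventually.of_forall fun x => ?_)
  have := hC' x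
  rw [Real.norm_of_nonneg (by positivity)]
  simp only [Pi.add_apply, pow_zero, one_mul]
  calc (1 + ‖x‖ ^ 2) * (‖φ x‖ * ‖ψ x‖) ≤ (1 + ‖x‖ ^ 2) * (‖φ x‖ * C) := by gcongr
    _ = _ := by ring

lemma int_of_le {F : Type*} [NormedAddCommGroup F] (φ ψ : S3) {h : E3 → F} (hc : Continuous h)
    (C : ℝ) (hb : ∀ x, ‖h x‖ ≤ C * ((1 + ‖x‖ ^ 2) * (‖φ x‖ * ‖ψ x‖))) : Integrable h :=
  ((int_base φ ψ).const_mul C).mono' hc.aestronglyMeasurable (Eventually.of_forall hb)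

lemma int_prod (φ ψ : S3) : Integrable (fun x : E3 => ‖φ x‖ * ‖ψ x‖) := by
  refine int_of_le φ ψ (by fun_prop) 1 fun x => ?_
  rw [Real.norm_of_nonneg (by positivity)]
  have : 0 ≤ ‖x‖ ^ 2 * (‖φ x‖ * ‖ψ x‖) := by positivity
  nlinarith

lemma int_sq (φ : S3) : Integrable (fun x : E3 => ‖φ x‖ ^ 2) := by
  simpa [sq] using int_prod φ φ

lemma int_x_sq (φ : S3) : Integrable (fun x : E3 => ‖x‖ ^ 2 * ‖φ x‖ ^ 2) := by
  refine int_of_le φ φ (by fun_prop) 1 fun x => ?_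
  rw [Real.norm_of_nonneg (by positivity)]
  have : 0 ≤ ‖φ x‖ ^ 2 := by positivity
  nlinarith

lemma q_sub (φ ψ : S3) : q (φ - ψ) ≤ 2 * q φ + 2 * q ψ := by
  unfold q
  rw [← integral_const_mul, ← integral_const_mul,
    ← integral_add ((int_sq φ).const_mul 2) ((int_sq ψ).const_mul 2)]
  refine integral_mono (int_sq _) (((int_sq φ).const_mul 2).add ((int_sq ψ).const_mul 2)) fun x => ?_
  have : ‖(φ - ψ) x‖ ≤ ‖φ x‖ + ‖ψ x‖ := by
    rw [_root_.sub_apply]; exact norm_sub_le _ _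
  have h0 := norm_nonneg ((φ - ψ) x)
  beta_reduce
  nlinarith [sq_nonneg (‖φ x‖ - ‖ψ x‖)]

lemma q_smul (c : ℝ) (φ : S3) : q (c • φ) = c ^ 2 * q φ := by
  unfold q
  rw [← integral_const_mul]
  congr 1; ext x
  rw [_root_.smul_apply, norm_smul, mul_pow]; simp

lemma q_zero : q 0 = 0 := by simp [q]

/-- AM-GM -/
lemma amgm (φ ψ : S3) {δ : ℝ} (hδ : 0 < δ) :
    ∫ x, 2 * (‖φ x‖ * ‖ψ x‖) ≤ δ * q φ + q ψ / δ := by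
  unfold q
  rw [div_eq_inv_mul, ← integral_const_mul, ← integral_const_mul,
    ← integral_add ((int_sq φ).const_mul _) ((int_sq ψ).const_mul _)]
  refine integral_mono ((int_prod φ ψ).const_mul 2)
    (((int_sq φ).const_mul _).add ((int_sq ψ).const_mul _)) fun x => ?_
  beta_reduce
  have h : δ * ‖φ x‖ ^ 2 + δ⁻¹ * ‖ψ x‖ ^ 2 - 2 * (‖φ x‖ * ‖ψ x‖)
    = δ⁻¹ * (δ * ‖φ x‖ - ‖ψ x‖) ^ 2 := by field_simp; ring
  have : 0 ≤ δ⁻¹ * (δ * ‖φ x‖ - ‖ψ x‖) ^ 2 := by positivity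
  linarith

/-- Fatou -/
lemma fatou {φn : ℕ → S3} {φ : S3} (h : ∀ x, Tendsto (fun n => φn n x) atTop (𝓝 (φ x)))
    {C : ℝ} (hC : ∀ᶠ n in atTop, q (φn n) ≤ C) : q φ ≤ C := by
  have hC0 : 0 ≤ C := by
    obtain ⟨n, hn⟩ := hC.exists
    exact (q_nonneg _).trans hn
  have e : ∀ ψ : S3, ENNReal.ofReal (q ψ) = ∫⁻ x, ENNReal.ofReal (‖ψ x‖ ^ 2) := fun ψ =>
    ofReal_integral_eq_lintegral_ofReal (int_sq ψ) (Eventually.of_forall fun x => by positivity)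
  rw [← ENNReal.ofReal_le_ofReal_iff hC0, e]
  have h1 : ∀ x, ENNReal.ofReal (‖φ x‖ ^ 2)
      = liminf (fun n => ENNReal.ofReal (‖φn n x‖ ^ 2)) atTop := fun x => by
    refine (Tendsto.liminf_eq ?_).symm
    exact ENNReal.tendsto_ofReal ((h x).norm.pow 2)
  simp_rw [h1]
  refine (lintegral_liminf_le fun n => by fun_prop).trans ?_
  refine liminf_le_of_le (by isBoundedDefault) ?_
  intro b hb
  obtain ⟨n, hn1, hn2⟩ := (hb.and hC).exists
  rw [← e] at hn1
  exact hn1.trans (ENNReal.ofReal_le_ofReal hn2)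

lemma ibp (f g : S3) (L : ℂ →L[ℝ] ℂ →L[ℝ] ℝ) (j : Fin 3) :
    ∫ x : E3, L (f x) (Dj j g x) = -∫ x : E3, L (Dj j f x) (g x) :=
  SchwartzMap.integral_bilinear_lineDerivOp_right_eq_neg_left f g L (ee j)

/-- gradient bound -/
lemma grad_bound {V : E3 → ℝ} {CV : ℝ} (hV : ∀ x, |V x| ≤ CV) {σ : ℝ} (hσ : σ ^ 2 = 1)
    {φ g : S3} (h : ∀ x, g x = σ * Complex.I * (∑ j, Dj j (Dj j φ) x - V x * φ x))
    {ε : ℝ} (hε : 0 < ε) :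
    ∑ j, q (Dj j φ) ≤ (1 / ε + CV) * q φ + ε * q g := by
  have h1 : ∀ j, q (Dj j φ) = -∫ x, inner ℝ (φ x) (Dj j (Dj j φ) x) := by
    intro j
    have : ∫ x, inner ℝ (φ x) (Dj j (Dj j φ) x) = - ∫ x, inner ℝ (Dj j φ x) (Dj j φ x) :=
      ibp φ (Dj j φ) (innerSL ℝ) j
    rw [this, neg_neg]; simp [q]
  have hint : ∀ j, Integrable (fun x => inner ℝ (φ x) (Dj j (Dj j φ) x)) := fun j => by
    refine (int_prod φ (Dj j (Dj j φ))).mono' (by fun_prop) (Eventually.of_forall fun x => ?_)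
    exact norm_inner_le_norm _ _
  simp_rw [h1]
  rw [Finset.sum_neg_distrib, ← integral_finsetSum _ (fun j _ => hint j), ← integral_neg]
  have hI : ∫ x, (CV * ‖φ x‖ ^ 2 + 2 * (‖φ x‖ * ‖g x‖)) ≤ (1 / ε + CV) * q φ + ε * q g := by
    rw [integral_add ((int_sq φ).const_mul _) ((int_prod φ g).const_mul 2), integral_const_mul]
    have := amgm φ g (δ := 1 / ε) (by positivity)
    have e : q g / (1 / ε) = ε * q g := by field_simp
    rw [e] at this
    have e2 : ∫ x, ‖φ x‖ ^ 2 = q φ := rfl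
    rw [e2, add_mul]
    linarith
  refine le_trans (integral_mono (integrable_finsetSum _ fun j _ => hint j).neg
    (((int_sq φ).const_mul _).add ((int_prod φ g).const_mul 2)) fun x => ?_) hI
  simp only [Pi.add_apply]
  rw [← inner_sum]
  have e : ∑ j, Dj j (Dj j φ) x = V x * φ x - σ * Complex.I * g x := by
    rw [h x]
    have : (σ : ℂ) * Complex.I * (σ * Complex.I * (∑ j, Dj j (Dj j φ) x - V x * φ x))
      = - ((σ ^ 2 : ℝ) : ℂ) * (∑ j, Dj j (Dj j φ) x - V x * φ x) := by
        push_cast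
        linear_combination (σ:ℂ) ^ 2 * (∑ j, Dj j (Dj j φ) x - V x * φ x) * Complex.I_sq
    rw [this, hσ]; push_cast; ring
  rw [e, inner_sub_right]
  have a1 : inner ℝ (φ x) ((V x : ℂ) * φ x) = V x * ‖φ x‖ ^ 2 := by
    rw [← Complex.real_smul, inner_smul_right, real_inner_self_eq_norm_sq]
  have a2 : inner ℝ (φ x) ((σ : ℂ) * Complex.I * g x) ≤ ‖φ x‖ * ‖g x‖ := by
    refine (real_inner_le_norm _ _).trans ?_
    have : |σ| = 1 := by
      rw [← sq_abs] at hσ; nlinarith [abs_nonneg σ]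
    simp [this]
  rw [a1]
  have := abs_le.mp (hV x)
  have : 0 ≤ ‖φ x‖ * ‖g x‖ := by positivity
  have : 0 ≤ ‖φ x‖ ^ 2 := by positivity
  nlinarith

/-- flux -/
noncomputable def P (w : E3 → ℝ) (φ : S3) : ℝ :=
  ∑ j, ∫ x, fderiv ℝ w x (ee j) * inner ℝ (φ x) (Complex.I * Dj j φ x)

lemma flux {w : E3 → ℝ} (hw : ContDiff ℝ ∞ w) (hc : HasCompactSupport w) (V : E3 → ℝ) (σ : ℝ)
    (φ : S3) (g : S3) (h : ∀ x, g x = σ * Complex.I * (∑ j, Dj j (Dj j φ) x - V x * φ x)) :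
    ∫ x, w x * inner ℝ (φ x) (g x) = - σ * P w φ := by
  have ht := hc.hasTemperateGrowth hw
  set f : S3 := SchwartzMap.smulLeftCLM ℂ w φ with hf
  have hfx : ∀ x, f x = w x • φ x := fun x => SchwartzMap.smulLeftCLM_apply_apply ht φ x
  have hDf : ∀ j x, Dj j f x = fderiv ℝ w x (ee j) • φ x + w x • Dj j φ x := by
    intro j x
    rw [Dj_apply, Dj_apply]
    have : (f : E3 → ℂ) = fun x => w x • φ x := funext hfx
    rw [this, fderiv_fun_smul (hw.differentiable (by simp) x) (φ.differentiable x)]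
    simp [add_comm]
  let L : ℂ →L[ℝ] ℂ →L[ℝ] ℝ :=
    (innerSL ℝ).bilinearComp (ContinuousLinearMap.id ℝ ℂ) (ContinuousLinearMap.mul ℝ ℂ Complex.I)
  have hL : ∀ z y, L z y = inner ℝ z (Complex.I * y) := fun z y => by simp [L]
  have h1 : ∀ j, ∫ x, w x * inner ℝ (φ x) (Complex.I * Dj j (Dj j φ) x)
      = - ∫ x, fderiv ℝ w x (ee j) * inner ℝ (φ x) (Complex.I * Dj j φ x) := by
    intro j
    have e1 : ∀ x, w x * inner ℝ (φ x) (Complex.I * Dj j (Dj j φ) x)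
        = L (f x) (Dj j (Dj j φ) x) := fun x => by
      rw [hL, hfx, real_inner_smul_left]
    have e2 : ∀ x, L (Dj j f x) (Dj j φ x)
        = fderiv ℝ w x (ee j) * inner ℝ (φ x) (Complex.I * Dj j φ x) := fun x => by
      have : inner ℝ (Dj j φ x) (Complex.I * Dj j φ x) = 0 := by
        simp [Complex.inner]; ring
      rw [hL, hDf, inner_add_left, real_inner_smul_left, real_inner_smul_left, this]; ring
    simp_rw [e1]
    rw [ibp]
    simp_rw [e2]
  have hint : ∀ j, Integrable (fun x => w x * inner ℝ (φ x) (Complex.I * Dj j (Dj j φ) x)) := by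
    intro j
    refine Continuous.integrable_of_hasCompactSupport ?_ hc.mul_right
    have := hw.continuous
    fun_prop
  have e : ∀ x, w x * inner ℝ (φ x) (g x)
      = σ * ∑ j, w x * inner ℝ (φ x) (Complex.I * Dj j (Dj j φ) x) := by
    intro x
    rw [h x, ← Finset.mul_sum, ← inner_sum, ← Finset.mul_sum]
    simp [Complex.inner]; ring
  simp_rw [e]
  rw [integral_const_mul, integral_finsetSum _ (fun j _ => hint j)]
  simp_rw [h1]
  simp [P]

end Dil

namespace Dil
open Filter Topology
open scoped LineDeriv

structure Sol (V : E3 → ℝ) (σ : ℝ) (u u1 : ℝ → S3) (f : S3) : Prop where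
  cont : Continuous (fun p : ℝ × E3 => u p.1 p.2)
  cont1 : Continuous (fun p : ℝ × E3 => u1 p.1 p.2)
  der : ∀ t x, HasDerivAt (fun τ => u τ x) (u1 t x) t
  eq : ∀ t x, (u1 t - f) x = σ * Complex.I * (∑ j, Dj j (Dj j (u t)) x - V x * u t x)

lemma time_deriv {V : E3 → ℝ} {σ : ℝ} {u u1 : ℝ → S3} {f : S3} (h : Sol V σ u u1 f)
    {w : E3 → ℝ} (hw : Continuous w) (hc : HasCompactSupport w) (t : ℝ) :
    HasDerivAt (fun τ => ∫ x, w x * ‖u τ x‖ ^ 2) (∫ x, w x * (2 * inner ℝ (u t x) (u1 t x))) t := by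
  have hcont : Continuous (fun p : ℝ × E3 => 2 * inner ℝ (u p.1 p.2) (u1 p.1 p.2)) := by
    have := h.cont
    have := h.cont1
    fun_prop
  obtain ⟨C, hC⟩ := ((isCompact_closedBall t 1).prod hc.isCompact).exists_bound_of_continuousOn
    hcont.continuousOn
  refine (hasDerivAt_integral_of_dominated_loc_of_deriv_le (μ := volume) (s := Metric.closedBall t 1)
    (bound := fun x => |w x| * C)
    (F := fun τ x => w x * ‖u τ x‖ ^ 2) (F' := fun τ x => w x * (2 * inner ℝ (u τ x) (u1 τ x)))
    (Metric.closedBall_mem_nhds t one_pos) ?_ ?_ ?_ ?_ ?_ ?_).2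
  · exact Eventually.of_forall fun τ => by fun_prop
  · refine Continuous.integrable_of_hasCompactSupport (by fun_prop) hc.mul_right
  · exact Continuous.aestronglyMeasurable (by fun_prop)
  · refine Eventually.of_forall fun x τ hτ => ?_
    rw [norm_mul, Real.norm_eq_abs (w x)]
    by_cases hx : x ∈ tsupport w
    · exact mul_le_mul_of_nonneg_left (hC (τ, x) ⟨hτ, hx⟩) (abs_nonneg _)
    · simp [image_eq_zero_of_notMem_tsupport hx]
  · refine Continuous.integrable_of_hasCompactSupport (by fun_prop) ?_
    exact (hc.norm).mul_right
  · refine Eventually.of_forall fun x τ _ => ?_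
    exact ((h.der τ x).norm_sq).const_mul _

lemma time_deriv' {V : E3 → ℝ} {σ : ℝ} {u u1 : ℝ → S3} {f : S3} (h : Sol V σ u u1 f)
    {w : E3 → ℝ} (hw : ContDiff ℝ ∞ w) (hc : HasCompactSupport w) (t : ℝ) :
    HasDerivAt (fun τ => ∫ x, w x * ‖u τ x‖ ^ 2)
      (-2 * σ * P w (u t) + 2 * ∫ x, w x * inner ℝ (u t x) (f x)) t := by
  convert! time_deriv h hw.continuous hc t using 1
  have h1 := flux hw hc V σ (u t) (u1 t - f) (h.eq t)
  have hwc := hw.continuous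
  have e : ∀ x, w x * (2 * inner ℝ (u t x) (u1 t x))
    = 2 * (w x * inner ℝ (u t x) ((u1 t - f) x)) + 2 * (w x * inner ℝ (u t x) (f x)) := by
    intro x
    rw [_root_.sub_apply, inner_sub_right]; ring
  simp_rw [e]
  rw [integral_add, integral_const_mul, integral_const_mul, h1]
  · ring
  · refine Continuous.integrable_of_hasCompactSupport (by fun_prop) ?_
    exact (hc.mul_right).mul_left
  · refine Continuous.integrable_of_hasCompactSupport (by fun_prop) ?_
    exact (hc.mul_right).mul_left

noncomputable def bump : ContDiffBump (0 : E3) := ⟨1, 2, one_pos, one_lt_two⟩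

lemma norm_ee (j : Fin 3) : ‖ee j‖ = 1 := by simp [ee]

noncomputable def chi (n : ℕ) (x : E3) : ℝ := bump (((n : ℝ) + 1)⁻¹ • x)

lemma chi_smooth (n : ℕ) : ContDiff ℝ ∞ (chi n) := by
  unfold chi
  exact bump.contDiff.comp (contDiff_const_smul _)

lemma chi_compact (n : ℕ) : HasCompactSupport (chi n) := by
  have : ((n : ℝ) + 1)⁻¹ ≠ 0 := by positivity
  exact bump.hasCompactSupport.comp_smul this

lemma chi_nonneg (n : ℕ) (x : E3) : 0 ≤ chi n x := bump.nonneg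
lemma chi_le (n : ℕ) (x : E3) : chi n x ≤ 1 := bump.le_one

lemma chi_one (n : ℕ) (x : E3) (hx : ‖x‖ ≤ n + 1) : chi n x = 1 := by
  apply bump.one_of_mem_closedBall
  simp only [bump, mem_closedBall_zero_iff, norm_smul, norm_inv]
  rw [Real.norm_of_nonneg (by positivity)]
  rw [inv_mul_le_iff₀ (by positivity)]; linarith

lemma chi_zero (n : ℕ) (x : E3) (hx : 2 * ((n : ℝ) + 1) ≤ ‖x‖) : chi n x = 0 := by
  apply bump.zero_of_le_dist
  simp only [bump, dist_zero_right, norm_smul, norm_inv]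
  rw [Real.norm_of_nonneg (by positivity)]
  rw [le_inv_mul_iff₀ (by positivity)]; linarith

lemma chi_deriv : ∃ C, 0 ≤ C ∧ ∀ (n : ℕ) x, ‖fderiv ℝ (chi n) x‖ ≤ C / (n + 1) := by
  have h1 : Continuous (fderiv ℝ (bump : E3 → ℝ)) :=
    (bump.contDiff (n := 1)).continuous_fderiv (by norm_num)
  obtain ⟨C, hC⟩ := (bump.hasCompactSupport.fderiv (𝕜 := ℝ)).exists_bound_of_continuous h1
  refine ⟨C, (norm_nonneg _).trans (hC 0), fun n x => ?_⟩
  have : fderiv ℝ (chi n) x = ((n : ℝ) + 1)⁻¹ • fderiv ℝ bump (((n : ℝ) + 1)⁻¹ • x) := by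
    unfold chi
    exact fderiv_comp_smul _
  rw [this, norm_smul, norm_inv, Real.norm_of_nonneg (by positivity : (0 : ℝ) ≤ n + 1),
    div_eq_inv_mul]
  gcongr
  exact hC _

lemma cut1 : ∃ C, 0 ≤ C ∧ ∀ n : ℕ, ∃ w : E3 → ℝ, ContDiff ℝ ∞ w ∧ HasCompactSupport w ∧
    (∀ x, 0 ≤ w x) ∧ (∀ x, w x ≤ 1) ∧ (∀ x, ‖x‖ ≤ n + 1 → w x = 1) ∧
    ∀ j x, |fderiv ℝ w x (ee j)| ≤ C / (n + 1) := by
  obtain ⟨C, hC0, hC⟩ := chi_deriv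
  refine ⟨C, hC0, fun n => ⟨chi n, chi_smooth n, chi_compact n, chi_nonneg n, chi_le n,
    chi_one n, fun j x => ?_⟩⟩
  have := (fderiv ℝ (chi n) x).le_opNorm (ee j)
  rw [norm_ee, mul_one] at this
  exact this.trans (hC n x)

lemma cut2 : ∃ C, 0 ≤ C ∧ ∀ n : ℕ, ∃ w : E3 → ℝ, ContDiff ℝ ∞ w ∧ HasCompactSupport w ∧
    (∀ x, 0 ≤ w x) ∧ (∀ x, w x ≤ ‖x‖ ^ 2) ∧ (∀ x, ‖x‖ ≤ n + 1 → w x = ‖x‖ ^ 2) ∧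
    (∀ j x, ‖x‖ < n + 1 → fderiv ℝ w x (ee j) = 2 * x j) ∧
    (∀ x, w x ≤ (2 * (n + 1)) ^ 2) ∧
    ∀ j x, (fderiv ℝ w x (ee j)) ^ 2 ≤ C * w x := by
  obtain ⟨C, hC0, hC⟩ := chi_deriv
  have hsm : ∀ n, ContDiff ℝ ∞ (fun x : E3 => ‖x‖ ^ 2 * (chi n x) ^ 2) := fun n =>
    (contDiff_norm_sq ℝ).mul ((chi_smooth n).pow 2)
  have hns : ∀ (j : Fin 3) (x : E3), fderiv ℝ (fun x : E3 => ‖x‖ ^ 2) x (ee j) = 2 * x j := by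
    intro j x
    rw [fderiv_norm_sq_apply]
    simp [ee, EuclideanSpace.inner_single_right]
  have hone : ∀ (n : ℕ) (x : E3), ‖x‖ ≤ n + 1 → ‖x‖ ^ 2 * (chi n x) ^ 2 = ‖x‖ ^ 2 := by
    intro n x hx
    rw [chi_one n x hx]; ring
  refine ⟨(2 + 4 * C) ^ 2, by positivity, fun n => ⟨fun x => ‖x‖ ^ 2 * (chi n x) ^ 2, hsm n,
    ?_, ?_, ?_, hone n, ?_, ?_, ?_⟩⟩
  · have : HasCompactSupport (fun x => (chi n x) ^ 2) := by
      simp_rw [sq]; exact (chi_compact n).mul_right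
    exact this.mul_left
  · intro x; positivity
  · intro x
    have := chi_nonneg n x
    have := chi_le n x
    have : (chi n x) ^ 2 ≤ 1 := by nlinarith
    exact mul_le_of_le_one_right (by positivity) this
  · intro j x hx
    rw [← hns j x]
    congr 1
    apply Filter.EventuallyEq.fderiv_eq
    have : ∀ᶠ y : E3 in 𝓝 x, ‖y‖ < n + 1 := continuous_norm.continuousAt.eventually_lt_const hx
    filter_upwards [this] with y hy
    exact hone n y hy.le
  · intro x
    by_cases hx : 2 * ((n : ℝ) + 1) ≤ ‖x‖
    · beta_reduce
      rw [chi_zero n x hx]; simp; positivity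
    · have := chi_nonneg n x
      have := chi_le n x
      have h1 : (chi n x) ^ 2 ≤ 1 := by nlinarith
      have h2 : ‖x‖ ^ 2 ≤ (2 * (n + 1)) ^ 2 := by
        gcongr; linarith
      exact (mul_le_of_le_one_right (by positivity) h1).trans h2
  · intro j x
    have d1 : DifferentiableAt ℝ (fun x : E3 => ‖x‖ ^ 2) x :=
      (contDiff_norm_sq ℝ (n := 1)).differentiable (by norm_num) x
    have d2 : DifferentiableAt ℝ (chi n) x := (chi_smooth n).differentiable (by simp) x
    have e : fderiv ℝ (fun x : E3 => ‖x‖ ^ 2 * (chi n x) ^ 2) x (ee j)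
        = 2 * x j * (chi n x) ^ 2 + 2 * ‖x‖ ^ 2 * chi n x * fderiv ℝ (chi n) x (ee j) := by
      rw [fderiv_fun_mul d1 (d2.fun_pow 2)]
      simp only [_root_.add_apply, _root_.smul_apply, smul_eq_mul, hns]
      rw [fderiv_fun_pow _ d2]
      simp; ring
    rw [e]
    have hxj : |x j| ≤ ‖x‖ := PiLp.norm_apply_le x j
    have hf : ‖x‖ * |fderiv ℝ (chi n) x (ee j)| * chi n x ≤ 2 * C * chi n x := by
      by_cases hx : 2 * ((n : ℝ) + 1) ≤ ‖x‖
      · rw [chi_zero n x hx]; simp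
      · have := (fderiv ℝ (chi n) x).le_opNorm (ee j)
        rw [norm_ee, mul_one] at this
        have h2 := this.trans (hC n x)
        refine mul_le_mul_of_nonneg_right ?_ (chi_nonneg n x)
        calc _ ≤ (2 * ((n : ℝ) + 1)) * (C / (n + 1)) := by
              gcongr
              · linarith
              · exact h2
          _ = 2 * C := by field_simp
    have c0 := chi_nonneg n x
    have c1 := chi_le n x
    have hb : |2 * x j * (chi n x) ^ 2 + 2 * ‖x‖ ^ 2 * chi n x * fderiv ℝ (chi n) x (ee j)|
        ≤ (2 + 4 * C) * (‖x‖ * chi n x) := by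
      refine (abs_add_le _ _).trans ?_
      rw [abs_mul, abs_mul, abs_mul, abs_mul, abs_mul, abs_of_nonneg c0]
      simp only [abs_pow, abs_norm, abs_of_nonneg c0, abs_two]
      have h1 : |x j| * (chi n x) ^ 2 ≤ ‖x‖ * chi n x := by
        have : (chi n x) ^ 2 ≤ chi n x := by nlinarith
        gcongr
      have h2 := mul_le_mul_of_nonneg_left hf (norm_nonneg x)
      nlinarith
    rw [← sq_abs]
    calc _ ≤ ((2 + 4 * C) * (‖x‖ * chi n x)) ^ 2 := by gcongr
      _ = _ := by ring

end Dil

namespace Dil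
open Filter Topology
open scoped LineDeriv

lemma ev_norm (x : E3) : ∀ᶠ n : ℕ in atTop, ‖x‖ < (n : ℝ) + 1 := by
  obtain ⟨N, hN⟩ := exists_nat_gt ‖x‖
  filter_upwards [eventually_ge_atTop N] with n hn
  have : (N : ℝ) ≤ n := by exact_mod_cast hn
  linarith

lemma inner_I_le (z y : ℂ) : |inner ℝ z (Complex.I * y)| ≤ ‖z‖ * ‖y‖ := by
  refine (abs_real_inner_le_norm _ _).trans ?_
  simp

lemma flux_bound1 {w : E3 → ℝ} {c : ℝ} (hc : 0 ≤ c) (hw : ∀ j x, |fderiv ℝ w x (ee j)| ≤ c)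
    (φ : S3) : |2 * P w φ| ≤ c * (3 * q φ + ∑ j, q (Dj j φ)) := by
  have h1 : ∀ j, |∫ x, fderiv ℝ w x (ee j) * inner ℝ (φ x) (Complex.I * Dj j φ x)|
      ≤ c / 2 * (q φ + q (Dj j φ)) := by
    intro j
    have := amgm φ (Dj j φ) one_pos
    rw [one_mul, div_one] at this
    rw [← Real.norm_eq_abs]
    calc _ ≤ ∫ x, c / 2 * (2 * (‖φ x‖ * ‖Dj j φ x‖)) := by
          refine norm_integral_le_of_norm_le (((int_prod φ (Dj j φ)).const_mul 2).const_mul _)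
            (Eventually.of_forall fun x => ?_)
          rw [norm_mul, Real.norm_eq_abs, Real.norm_eq_abs]
          calc _ ≤ c * (‖φ x‖ * ‖Dj j φ x‖) :=
                mul_le_mul (hw j x) (inner_I_le _ _) (abs_nonneg _) hc
            _ = _ := by ring
      _ = c / 2 * ∫ x, (2 * (‖φ x‖ * ‖Dj j φ x‖)) := integral_const_mul _ _
      _ ≤ _ := by gcongr
  rw [abs_mul, abs_two]
  have h2 : |P w φ| ≤ ∑ j, c / 2 * (q φ + q (Dj j φ)) :=
    (Finset.abs_sum_le_sum_abs _ _).trans (Finset.sum_le_sum fun j _ => h1 j)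
  rw [← Finset.mul_sum, Finset.sum_add_distrib] at h2
  simp only [Finset.sum_const, Finset.card_univ, Fintype.card_fin, nsmul_eq_mul] at h2
  push_cast at h2
  linarith

lemma energy {V : E3 → ℝ} {CV : ℝ} (hV : ∀ x, |V x| ≤ CV) {σ : ℝ} (hσ : σ ^ 2 = 1)
    {u u1 : ℝ → S3} {f : S3} (h : Sol V σ u u1 f) {s t S S1 : ℝ}
    (hS : ∀ τ ∈ Set.uIcc s t, q (u τ) ≤ S) (hS1 : ∀ τ ∈ Set.uIcc s t, q (u1 τ) ≤ S1)
    {δ : ℝ} (hδ : 0 < δ) : |q (u t) - q (u s)| ≤ (δ * S + q f / δ) * |t - s| := by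
  obtain ⟨C, hC0, hC⟩ := cut1
  choose w w1 w2 w3 w4 w5 w6 using hC
  have hCV : 0 ≤ CV := (abs_nonneg _).trans (hV 0)
  have hσ1 : |σ| = 1 := by
    rw [← sq_abs] at hσ; nlinarith [abs_nonneg σ]
  set B : ℝ := 3 * S + ((1 + CV) * S + (2 * S1 + 2 * q f)) with hB
  have hlim : ∀ τ, Tendsto (fun n => ∫ x, w n x * ‖u τ x‖ ^ 2) atTop (𝓝 (q (u τ))) := by
    intro τ
    refine tendsto_integral_of_dominated_convergence (fun x => ‖u τ x‖ ^ 2) ?_ (int_sq _) ?_ ?_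
    · intro n
      have := (w1 n).continuous
      exact Continuous.aestronglyMeasurable (by fun_prop)
    · intro n
      refine Eventually.of_forall fun x => ?_
      have := w3 n x
      rw [Real.norm_of_nonneg (by positivity)]
      exact mul_le_of_le_one_left (by positivity) (w4 n x)
    · refine Eventually.of_forall fun x => ?_
      refine tendsto_const_nhds.congr' ?_
      filter_upwards [ev_norm x] with n hn
      rw [w5 n x hn.le, one_mul]
  have hn : ∀ n : ℕ, |(∫ x, w n x * ‖u t x‖ ^ 2) - ∫ x, w n x * ‖u s x‖ ^ 2|
      ≤ (C * B * (1 / ((n : ℝ) + 1)) + (δ * S + q f / δ)) * |t - s| := by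
    intro n
    refine (convex_uIcc s t).norm_image_sub_le_of_norm_hasDerivWithin_le
      (f := fun τ => ∫ x, w n x * ‖u τ x‖ ^ 2)
      (fun τ _ => (time_deriv' h (w1 n) (w2 n) τ).hasDerivWithinAt) (fun τ hτ => ?_)
      Set.left_mem_uIcc Set.right_mem_uIcc
    refine (norm_add_le _ _).trans (add_le_add ?_ ?_)
    · have h1 := flux_bound1 (div_nonneg hC0 (by positivity)) (w6 n) (u τ)
      have h2 := grad_bound hV hσ (h.eq τ) one_pos
      have h3 := q_sub (u1 τ) f
      have e : ‖-2 * σ * P (w n) (u τ)‖ = |2 * P (w n) (u τ)| := by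
        rw [Real.norm_eq_abs, abs_mul, abs_mul, abs_mul, hσ1]; simp
      rw [e]
      refine h1.trans ?_
      have : C * B * (1 / ((n : ℝ) + 1)) = C / (n + 1) * B := by ring
      rw [this]
      have := hS τ hτ
      have := hS1 τ hτ
      have h4 : (1 + CV) * q (u τ) ≤ (1 + CV) * S := by gcongr
      refine mul_le_mul_of_nonneg_left ?_ (by positivity)
      rw [hB]
      linarith
    · have h1 := amgm (u τ) f hδ
      rw [integral_const_mul] at h1
      rw [norm_mul, Real.norm_two]
      have h2 : ‖∫ x, w n x * inner ℝ (u τ x) (f x)‖ ≤ ∫ x, ‖u τ x‖ * ‖f x‖ := by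
        refine norm_integral_le_of_norm_le (int_prod _ _) (Eventually.of_forall fun x => ?_)
        rw [norm_mul, Real.norm_of_nonneg (w3 n x)]
        calc _ ≤ 1 * (‖u τ x‖ * ‖f x‖) :=
              mul_le_mul (w4 n x) (norm_inner_le_norm _ _) (norm_nonneg _) zero_le_one
          _ = _ := one_mul _
      have h3 : δ * q (u τ) ≤ δ * S := by gcongr; exact hS τ hτ
      linarith
  have l1 := ((hlim t).sub (hlim s)).abs
  have l2 : Tendsto (fun n : ℕ => (C * B * (1 / ((n : ℝ) + 1)) + (δ * S + q f / δ)) * |t - s|) atTop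
      (𝓝 ((C * B * 0 + (δ * S + q f / δ)) * |t - s|)) :=
    ((tendsto_one_div_add_atTop_nhds_zero_nat.const_mul _).add_const _).mul_const _
  have := le_of_tendsto_of_tendsto' l1 l2 hn
  simpa using this

lemma conserve {V : E3 → ℝ} {CV : ℝ} (hV : ∀ x, |V x| ≤ CV) {σ : ℝ} (hσ : σ ^ 2 = 1)
    {u u1 : ℝ → S3} (h : Sol V σ u u1 0) {s t S S1 : ℝ}
    (hS : ∀ τ ∈ Set.uIcc s t, q (u τ) ≤ S) (hS1 : ∀ τ ∈ Set.uIcc s t, q (u1 τ) ≤ S1) :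
    q (u t) = q (u s) := by
  have h1 : ∀ δ : ℝ, 0 < δ → |q (u t) - q (u s)| ≤ δ * (S * |t - s|) := fun δ hδ => by
    have := energy hV hσ h hS hS1 hδ
    rw [q_zero] at this
    simpa [mul_assoc] using this
  have h2 : Tendsto (fun δ : ℝ => δ * (S * |t - s|)) (𝓝[>] 0) (𝓝 (0 * (S * |t - s|))) :=
    (tendsto_id.mul_const _).mono_left nhdsWithin_le_nhds
  have h3 := ge_of_tendsto h2 (eventually_nhdsWithin_of_forall h1)
  rw [zero_mul] at h3
  have := abs_nonpos_iff.mp h3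
  linarith

lemma energy2 {V : E3 → ℝ} {CV : ℝ} (hV : ∀ x, |V x| ≤ CV) {σ : ℝ} (hσ : σ ^ 2 = 1)
    {u u1 : ℝ → S3} {f : S3} (h : Sol V σ u u1 f) {s t S S1 : ℝ}
    (hS : ∀ τ ∈ Set.uIcc s t, q (u τ) ≤ S) (hS1 : ∀ τ ∈ Set.uIcc s t, q (u1 τ) ≤ S1) :
    q (u t) ≤ 2 * q (u s) + 4 * (t - s) ^ 2 * q f := by
  by_cases hts : t = s
  · subst hts; have := q_nonneg (u t); simp; linarith
  have hpos : 0 < |t - s| := abs_pos.mpr (sub_ne_zero.mpr hts)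
  set A := (fun τ => q (u τ)) '' Set.uIcc s t
  have hb : BddAbove A := ⟨S, by rintro _ ⟨τ, hτ, rfl⟩; exact hS τ hτ⟩
  have hle : ∀ τ ∈ Set.uIcc s t, q (u τ) ≤ sSup A := fun τ hτ => le_csSup hb ⟨τ, hτ, rfl⟩
  have hA0 : 0 ≤ sSup A := (q_nonneg _).trans (hle t Set.right_mem_uIcc)
  set δ := 1 / (2 * |t - s|) with hδ
  have hδ0 : 0 < δ := by positivity
  have key : sSup A ≤ q (u s) + (sSup A / 2 + 2 * (t - s) ^ 2 * q f) := by
    refine csSup_le ⟨_, t, Set.right_mem_uIcc, rfl⟩ ?_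
    rintro _ ⟨τ, hτ, rfl⟩
    have hsub : Set.uIcc s τ ⊆ Set.uIcc s t := Set.uIcc_subset_uIcc Set.left_mem_uIcc hτ
    have := energy hV hσ h (s := s) (t := τ) (fun r hr => hle r (hsub hr))
      (fun r hr => hS1 r (hsub hr)) hδ0
    have h2 : |τ - s| ≤ |t - s| := Set.abs_sub_left_of_mem_uIcc hτ
    have h3 : (δ * sSup A + q f / δ) * |τ - s| ≤ (δ * sSup A + q f / δ) * |t - s| := by
      have := q_nonneg f
      gcongr
    have h4 : (δ * sSup A + q f / δ) * |t - s| = sSup A / 2 + 2 * (t - s) ^ 2 * q f := by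
      rw [hδ, ← sq_abs (t - s)]; field_simp
    have := abs_le.mp this
    beta_reduce
    linarith
  have := hle t Set.right_mem_uIcc
  linarith

end Dil

namespace Dil
open Filter Topology
open scoped LineDeriv

lemma Sol.diff {V : E3 → ℝ} {σ : ℝ} {u u1 : ℝ → S3} (h : Sol V σ u u1 0) (d : ℝ) :
    Sol V σ (fun t => u (t + d) - u t) (fun t => u1 (t + d) - u1 t) 0 where
  cont := by
    have h1 := h.cont
    have h2 : Continuous (fun p : ℝ × E3 => u (p.1 + d) p.2) :=
      h1.comp (f := fun p : ℝ × E3 => (p.1 + d, p.2)) (by fun_prop)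
    exact h2.sub h1
  cont1 := by
    have h1 := h.cont1
    have h2 : Continuous (fun p : ℝ × E3 => u1 (p.1 + d) p.2) :=
      h1.comp (f := fun p : ℝ × E3 => (p.1 + d, p.2)) (by fun_prop)
    exact h2.sub h1
  der t x := ((h.der (t + d) x).comp_add_const t d).sub (h.der t x)
  eq t x := by
    have h1 := h.eq (t + d) x
    have h2 := h.eq t x
    simp only [sub_zero, map_sub, _root_.sub_apply, Finset.sum_sub_distrib] at h1 h2 ⊢
    rw [h1, h2]; ring

lemma Sol.sub_const {V : E3 → ℝ} {σ : ℝ} {u u1 : ℝ → S3} (h : Sol V σ u u1 0) (a : ℝ) :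
    Sol V σ (fun t => u t - u a) u1 (u1 a) where
  cont := h.cont.sub ((u a).continuous.comp continuous_snd)
  cont1 := h.cont1
  der t x := (h.der t x).sub_const _
  eq t x := by
    have h1 := h.eq t x
    have h2 := h.eq a x
    simp only [sub_zero, map_sub, _root_.sub_apply, Finset.sum_sub_distrib] at h1 h2 ⊢
    rw [h1, h2]; ring

lemma Sol.shift {V : E3 → ℝ} {σ : ℝ} {u u1 : ℝ → S3} (h : Sol V σ u u1 0) (a θ : ℝ) :
    Sol V (θ * σ) (fun r => u (a + θ * r)) (fun r => θ • u1 (a + θ * r)) 0 where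
  cont := h.cont.comp (f := fun p : ℝ × E3 => (a + θ * p.1, p.2)) (by fun_prop)
  cont1 := (h.cont1.comp (f := fun p : ℝ × E3 => (a + θ * p.1, p.2)) (by fun_prop)).const_smul θ
  der t x := by
    have h1 : HasDerivAt (fun r : ℝ => a + θ * r) θ t := by
      simpa using ((hasDerivAt_id t).const_mul θ).const_add a
    exact (h.der (a + θ * t) x).scomp t h1
  eq t x := by
    have h1 := h.eq (a + θ * t) x
    simp only [sub_zero, _root_.smul_apply] at h1 ⊢
    rw [h1, Complex.real_smul]; push_cast; ring

lemma Sol.cont_at {V : E3 → ℝ} {σ : ℝ} {u u1 : ℝ → S3} {f : S3} (h : Sol V σ u u1 f) (x : E3) :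
    Continuous (fun t => u t x) :=
  h.cont.comp (f := fun t : ℝ => (t, x)) (by fun_prop)

lemma Sol.cont1_at {V : E3 → ℝ} {σ : ℝ} {u u1 : ℝ → S3} {f : S3} (h : Sol V σ u u1 f) (x : E3) :
    Continuous (fun t => u1 t x) :=
  h.cont1.comp (f := fun t : ℝ => (t, x)) (by fun_prop)

lemma gap {V : E3 → ℝ} {CV : ℝ} (hV : ∀ x, |V x| ≤ CV) {σ : ℝ} (hσ : σ ^ 2 = 1)
    {u u1 : ℝ → S3} (h : Sol V σ u u1 0) {ρ : ℝ} (hρ : 0 < ρ)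
    (hb : ∀ s, 0 < s → s ≤ ρ → ∃ C, ∀ τ ∈ Set.Icc s ρ, q (u τ) ≤ C ∧ q (u1 τ) ≤ C) :
    q (u ρ) ≤ 2 * q (u 0) + 8 * ρ ^ 2 * q (u1 0) ∧ q (u1 ρ) ≤ 40 * q (u1 0) := by
  -- invariance of differences
  have hinv : ∀ s t d, 0 < s → 0 < t → 0 ≤ d → s + d ≤ ρ → t + d ≤ ρ →
      q (u (t + d) - u t) = q (u (s + d) - u s) := by
    intro s t d hs ht hd hsd htd
    obtain ⟨C, hC⟩ := hb (min s t) (lt_min hs ht) ((min_le_left _ _).trans (by linarith))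
    refine conserve hV hσ (h.diff d) (S := 2 * C + 2 * C) (S1 := 2 * C + 2 * C) ?_ ?_
    · intro τ hτ
      have hl : min s t ≤ τ := hτ.1
      have hr : τ + d ≤ ρ := by
        have : τ ≤ max s t := hτ.2
        have : max s t ≤ ρ - d := max_le (by linarith) (by linarith)
        linarith
      have h1 := (hC τ ⟨hl, by linarith⟩).1
      have h2 := (hC (τ + d) ⟨by linarith, hr⟩).1
      have := q_sub (u (τ + d)) (u τ)
      linarith
    · intro τ hτ
      have hl : min s t ≤ τ := hτ.1
      have hr : τ + d ≤ ρ := by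
        have : τ ≤ max s t := hτ.2
        have : max s t ≤ ρ - d := max_le (by linarith) (by linarith)
        linarith
      have h1 := (hC τ ⟨hl, by linarith⟩).2
      have h2 := (hC (τ + d) ⟨by linarith, hr⟩).2
      have := q_sub (u1 (τ + d)) (u1 τ)
      linarith
  -- inhomogeneous estimate
  have hinh : ∀ a s t, 0 < s → s ≤ t → t ≤ ρ →
      q (u t - u a) ≤ 2 * q (u s - u a) + 4 * (t - s) ^ 2 * q (u1 a) := by
    intro a s t hs hst ht
    obtain ⟨C, hC⟩ := hb s hs (hst.trans ht)
    refine energy2 hV hσ (h.sub_const a) (S := 2 * C + 2 * q (u a)) (S1 := C) ?_ ?_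
    · intro τ hτ
      rw [Set.uIcc_of_le hst] at hτ
      have := (hC τ ⟨hτ.1, hτ.2.trans ht⟩).1
      have := q_sub (u τ) (u a)
      linarith
    · intro τ hτ
      rw [Set.uIcc_of_le hst] at hτ
      exact (hC τ ⟨hτ.1, hτ.2.trans ht⟩).2
  set L := 4 * q (u1 (ρ / 2)) with hL
  have hL0 : 0 ≤ L := by have := q_nonneg (u1 (ρ / 2)); positivity
  have hlip : ∀ s t, 0 < s → s ≤ t → t ≤ ρ / 2 → q (u t - u s) ≤ t ^ 2 * L := by
    intro s t hs hst ht
    have h1 := hinv (ρ / 2) s (t - s) (by linarith) hs (by linarith) (by linarith) (by linarith)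
    have h2 := hinh (ρ / 2) (ρ / 2) (ρ / 2 + (t - s)) (by linarith) (by linarith) (by linarith)
    rw [sub_self, q_zero] at h2
    rw [show s + (t - s) = t by ring] at h1
    have h3 : (t - s) ^ 2 ≤ t ^ 2 := by
      have : 0 ≤ t - s := by linarith
      gcongr; linarith
    rw [h1]
    have := mul_le_mul_of_nonneg_right h3 hL0
    rw [show ρ / 2 + (t - s) - ρ / 2 = t - s by ring] at h2
    nlinarith
  have hz : Tendsto (fun n : ℕ => ρ / 2 * (1 / ((n : ℝ) + 1))) atTop (𝓝 0) := by
    simpa using tendsto_one_div_add_atTop_nhds_zero_nat.const_mul (ρ / 2)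
  have hzpos : ∀ n : ℕ, 0 < ρ / 2 * (1 / ((n : ℝ) + 1)) := fun n => by positivity
  have hlip0 : ∀ t, 0 < t → t ≤ ρ / 2 → q (u t - u 0) ≤ t ^ 2 * L := by
    intro t ht htρ
    refine fatou (φn := fun n => u t - u (ρ / 2 * (1 / ((n : ℝ) + 1)))) ?_ ?_
    · intro x
      exact tendsto_const_nhds.sub (((h.cont_at x).tendsto 0).comp hz)
    · filter_upwards [hz.eventually_le_const ht] with n hn
      exact hlip _ _ (hzpos n) hn htρ
  have hmain : ∀ t, 0 < t → t ≤ ρ → q (u t - u 0) ≤ 4 * t ^ 2 * q (u1 0) := by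
    intro t ht htρ
    have l : Tendsto (fun s : ℝ => 2 * (s ^ 2 * L) + 4 * (t - s) ^ 2 * q (u1 0)) (𝓝[>] 0)
        (𝓝 (2 * ((0 : ℝ) ^ 2 * L) + 4 * (t - 0) ^ 2 * q (u1 0))) := by
      have : Continuous (fun s : ℝ => 2 * (s ^ 2 * L) + 4 * (t - s) ^ 2 * q (u1 0)) := by fun_prop
      exact (this.tendsto 0).mono_left nhdsWithin_le_nhds
    have := ge_of_tendsto l (b := q (u t - u 0)) ?_
    · simpa using this
    · have hm : Set.Ioo 0 (min t (ρ / 2)) ∈ 𝓝[>] (0 : ℝ) :=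
        Ioo_mem_nhdsGT (lt_min ht (by linarith))
      filter_upwards [hm] with s hs
      have h1 := hs.2.trans_le (min_le_left _ _)
      have h2 := hs.2.trans_le (min_le_right _ _)
      have := hinh 0 s t hs.1 h1.le htρ
      have := hlip0 s hs.1 h2.le
      linarith
  constructor
  · have h1 := hmain ρ hρ le_rfl
    have h2 := q_sub (u ρ - u 0) (0 - u 0)
    have h3 : u ρ - u 0 - (0 - u 0) = u ρ := by abel
    have h4 : q (0 - u 0) = q (u 0) := by
      simp [q]
    rw [h3, h4] at h2
    linarith
  · have hd : ∀ d, 0 < d → d ≤ ρ / 2 → q (u ρ - u (ρ - d)) ≤ 40 * d ^ 2 * q (u1 0) := by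
      intro d hd hdρ
      by_cases hdd : ρ - d ≤ 0
      · linarith
      have h1 := hinv d (ρ - d) d hd (by linarith) hd.le (by linarith) (by linarith)
      rw [show ρ - d + d = ρ by ring] at h1
      rw [h1]
      have h2 := hmain d hd (by linarith)
      have h3 := hmain (d + d) (by linarith) (by linarith)
      have h4 := q_sub (u (d + d) - u 0) (u d - u 0)
      rw [sub_sub_sub_cancel_right] at h4
      nlinarith
    refine fatou (φn := fun n : ℕ => (ρ / 2 * (1 / ((n : ℝ) + 1)))⁻¹ •
      (u ρ - u (ρ - ρ / 2 * (1 / ((n : ℝ) + 1))))) ?_ ?_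
    · intro x
      have h1 := (hasDerivAt_iff_tendsto_slope_zero.mp (h.der ρ x))
      have h2 : Tendsto (fun n : ℕ => -(ρ / 2 * (1 / ((n : ℝ) + 1)))) atTop (𝓝[≠] 0) := by
        rw [tendsto_nhdsWithin_iff]
        refine ⟨by simpa using hz.neg, Eventually.of_forall fun n => ?_⟩
        have := hzpos n
        simp only [Set.mem_compl_iff, Set.mem_singleton_iff]
        linarith
      refine (h1.comp h2).congr fun n => ?_
      simp only [Function.comp, _root_.smul_apply, _root_.sub_apply, inv_neg, neg_smul, ← sub_eq_add_neg]
      rw [← smul_neg, neg_sub]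
    · refine Eventually.of_forall fun n => ?_
      have h0 := hzpos n
      have h1 : ρ / 2 * (1 / ((n : ℝ) + 1)) ≤ ρ / 2 := by
        refine mul_le_of_le_one_right (by linarith) ?_
        rw [div_le_one (by positivity)]
        have : (0 : ℝ) ≤ n := by positivity
        linarith
      have := hd _ h0 h1
      set d := ρ / 2 * (1 / ((n : ℝ) + 1))
      beta_reduce
      rw [q_smul, inv_pow, inv_mul_le_iff₀ (by positivity)]
      linarith

end Dil

namespace Dil
open Filter Topology
open scoped LineDeriv

def Good (u u1 : ℝ → S3) (t : ℝ) : Prop := ∃ C, ∀ᶠ τ in 𝓝 t, q (u τ) ≤ C ∧ q (u1 τ) ≤ C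

lemma good_compact {u u1 : ℝ → S3} {K : Set ℝ} (hK : IsCompact K) (h : ∀ t ∈ K, Good u u1 t) :
    ∃ C, ∀ t ∈ K, q (u t) ≤ C ∧ q (u1 t) ≤ C := by
  refine hK.induction_on (p := fun s => ∃ C, ∀ t ∈ s, q (u t) ≤ C ∧ q (u1 t) ≤ C) ⟨0, by simp⟩
    ?_ ?_ ?_
  · rintro s t hst ⟨C, hC⟩
    exact ⟨C, fun x hx => hC x (hst hx)⟩
  · rintro s t ⟨C, hC⟩ ⟨C', hC'⟩
    refine ⟨max C C', ?_⟩
    rintro x (hx | hx)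
    · exact ⟨(hC x hx).1.trans (le_max_left _ _), (hC x hx).2.trans (le_max_left _ _)⟩
    · exact ⟨(hC' x hx).1.trans (le_max_right _ _), (hC' x hx).2.trans (le_max_right _ _)⟩
  · intro x hx
    obtain ⟨C, hC⟩ := h x hx
    exact ⟨_, mem_nhdsWithin_of_mem_nhds hC, C, fun t ht => ht⟩

lemma gap' {V : E3 → ℝ} {CV : ℝ} (hV : ∀ x, |V x| ≤ CV) {σ : ℝ} (hσ : σ ^ 2 = 1)
    {u u1 : ℝ → S3} (h : Sol V σ u u1 0) {a θ ρ M : ℝ} (hθ : θ ^ 2 = 1) (hρ : 0 < ρ) (hρ1 : ρ ≤ 1)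
    (ha : q (u a) ≤ M ∧ q (u1 a) ≤ M)
    (hg : ∀ r, 0 < r → r ≤ ρ → Good u u1 (a + θ * r)) :
    q (u (a + θ * ρ)) ≤ 40 * M ∧ q (u1 (a + θ * ρ)) ≤ 40 * M := by
  have hM : 0 ≤ M := (q_nonneg _).trans ha.1
  have hσ' : (θ * σ) ^ 2 = 1 := by rw [mul_pow, hθ, hσ, one_mul]
  have := gap hV hσ' (h.shift a θ) hρ ?_
  · simp only [q_smul, hθ, one_mul, mul_zero, add_zero] at this
    obtain ⟨h1, h2⟩ := this
    refine ⟨?_, by linarith⟩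
    have : ρ ^ 2 ≤ 1 := by nlinarith
    have h3 : 8 * ρ ^ 2 * q (u1 a) ≤ 8 * 1 * M := by
      have := q_nonneg (u1 a)
      gcongr
      exact ha.2
    linarith
  · intro s hs hsρ
    obtain ⟨C, hC⟩ := good_compact (u := u) (u1 := u1)
      (K := (fun r => a + θ * r) '' Set.Icc s ρ)
      (isCompact_Icc.image (by fun_prop)) (by
        rintro _ ⟨r, hr, rfl⟩
        exact hg r (hs.trans_le hr.1) hr.2)
    refine ⟨C, fun τ hτ => ?_⟩
    simp only [q_smul, hθ, one_mul]
    exact hC _ ⟨τ, hτ, rfl⟩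

lemma all_good {V : E3 → ℝ} {CV : ℝ} (hV : ∀ x, |V x| ≤ CV) {σ : ℝ} (hσ : σ ^ 2 = 1)
    {u u1 : ℝ → S3} (h : Sol V σ u u1 0) (t : ℝ) : Good u u1 t := by
  set K : Set ℝ := {t | ¬ Good u u1 t} with hKdef
  have hKc : IsClosed K := by
    rw [← isOpen_compl_iff]
    rw [isOpen_iff_mem_nhds]
    intro x hx
    simp only [hKdef, Set.mem_compl_iff, Set.mem_setOf_eq, not_not] at hx
    obtain ⟨C, hC⟩ := hx
    filter_upwards [eventually_eventually_nhds.mpr hC] with y hy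
    simp only [hKdef, Set.mem_compl_iff, Set.mem_setOf_eq, not_not]
    exact ⟨C, hy⟩
  by_contra ht
  have htK : t ∈ K := ht
  let F : ℕ → Set ℝ := fun n => {t | q (u t) ≤ n ∧ q (u1 t) ≤ n}
  have hF : ∀ n, IsClosed (F n) := by
    intro n
    apply IsSeqClosed.isClosed
    intro s a hs ha
    constructor
    · refine fatou (φn := fun k => u (s k)) (fun x => ((h.cont_at x).tendsto a).comp ha) ?_
      exact Eventually.of_forall fun k => (hs k).1
    · refine fatou (φn := fun k => u1 (s k)) (fun x => ((h.cont1_at x).tendsto a).comp ha) ?_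
      exact Eventually.of_forall fun k => (hs k).2
  have : CompleteSpace K := hKc.completeSpace_coe
  have : Nonempty K := ⟨⟨t, htK⟩⟩
  obtain ⟨n, ⟨c, hcK⟩, hc⟩ := nonempty_interior_of_iUnion_of_closed
    (f := fun n => ((↑) : K → ℝ) ⁻¹' F n) (fun n => (hF n).preimage continuous_subtype_val) (by
      rw [Set.eq_univ_iff_forall]
      intro x
      obtain ⟨n, hn⟩ := exists_nat_ge (max (q (u x)) (q (u1 x)))
      exact Set.mem_iUnion.mpr ⟨n, (le_max_left _ _).trans hn, (le_max_right _ _).trans hn⟩)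
  rw [mem_interior_iff_mem_nhds, nhds_subtype, mem_comap] at hc
  obtain ⟨O, hO, hOF⟩ := hc
  obtain ⟨ε, hε, hball⟩ := Metric.mem_nhds_iff.mp hO
  have hKF : ∀ s ∈ K, |s - c| < ε → q (u s) ≤ n ∧ q (u1 s) ≤ n := by
    intro s hs hsc
    exact @hOF ⟨s, hs⟩ (hball hsc)
  apply hcK
  refine ⟨40 * n, ?_⟩
  have hb : Metric.ball c (min ε 1) ∈ 𝓝 c := Metric.ball_mem_nhds c (lt_min hε one_pos)
  filter_upwards [hb] with s hs
  have hs1 : |s - c| < ε := lt_of_lt_of_le hs (min_le_left _ _)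
  have hs2 : |s - c| < 1 := lt_of_lt_of_le hs (min_le_right _ _)
  have hn0 : (0 : ℝ) ≤ n := by positivity
  by_cases hsK : s ∈ K
  · have := hKF s hsK hs1
    constructor <;> linarith
  rcases lt_trichotomy c s with hcs | hcs | hcs
  · set a := sSup (K ∩ Set.Icc c s)
    have hcomp : IsCompact (K ∩ Set.Icc c s) := isCompact_Icc.inter_left hKc
    have haK : a ∈ K ∩ Set.Icc c s := hcomp.sSup_mem ⟨c, hcK, le_rfl, hcs.le⟩
    have has : a < s := lt_of_le_of_ne haK.2.2 (fun e => hsK (e ▸ haK.1))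
    have hca := haK.2.1
    rw [abs_of_pos (by linarith)] at hs1 hs2
    have := gap' hV hσ h (a := a) (θ := 1) (ρ := s - a) (M := n) (by norm_num) (by linarith)
      (by linarith) (hKF a haK.1 (by rw [abs_of_nonneg (by linarith)]; linarith)) ?_
    · simpa using this
    · intro r hr hrρ
      by_contra hbad
      have : a + 1 * r ≤ a := le_csSup hcomp.bddAbove ⟨hbad, by linarith, by linarith⟩
      linarith
  · subst hcs; exact absurd hcK hsK
  · set a := sInf (K ∩ Set.Icc s c)
    have hcomp : IsCompact (K ∩ Set.Icc s c) := isCompact_Icc.inter_left hKc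
    have haK : a ∈ K ∩ Set.Icc s c := hcomp.sInf_mem ⟨c, hcK, hcs.le, le_rfl⟩
    have has : s < a := lt_of_le_of_ne haK.2.1 (fun e => hsK (e ▸ haK.1))
    have hca := haK.2.2
    rw [abs_of_neg (by linarith)] at hs1 hs2
    have := gap' hV hσ h (a := a) (θ := -1) (ρ := a - s) (M := n) (by norm_num) (by linarith)
      (by linarith) (hKF a haK.1 (by rw [abs_of_nonpos (by linarith)]; linarith)) ?_
    · simpa using this
    · intro r hr hrρ
      by_contra hbad
      have : a ≤ a + -1 * r := csInf_le hcomp.bddBelow ⟨hbad, by linarith, by linarith⟩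
      linarith

end Dil

namespace Dil
open Filter Topology
open scoped LineDeriv

lemma tb {a w g : E3 → ℝ} (ha : Continuous a) (hac : HasCompactSupport a) (hw : Continuous w)
    (hwc : HasCompactSupport w) {C : ℝ} (haw : ∀ x, (a x) ^ 2 ≤ C * w x) (φ ψ : S3)
    (hg : Continuous g) (hgb : ∀ x, |g x| ≤ ‖φ x‖ * ‖ψ x‖) {η : ℝ} (hη : 0 < η) :
    |2 * ∫ x, a x * g x| ≤ η * C * (∫ x, w x * ‖φ x‖ ^ 2) + q ψ / η := by
  have i1 : Integrable (fun x => η * C * (w x * ‖φ x‖ ^ 2)) := by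
    refine Integrable.const_mul ?_ _
    exact Continuous.integrable_of_hasCompactSupport (by fun_prop) hwc.mul_right
  have i2 : Integrable (fun x => ‖ψ x‖ ^ 2 / η) := (int_sq ψ).div_const _
  have e : η * C * (∫ x, w x * ‖φ x‖ ^ 2) + q ψ / η
      = ∫ x, (η * C * (w x * ‖φ x‖ ^ 2) + ‖ψ x‖ ^ 2 / η) := by
    rw [integral_add i1 i2, integral_const_mul, integral_div]; rfl
  rw [e, ← integral_const_mul, ← Real.norm_eq_abs]
  refine norm_integral_le_of_norm_le (i1.add i2) (Eventually.of_forall fun x => ?_)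
  simp only [Real.norm_eq_abs, abs_mul, abs_two]
  have h1 := mul_le_mul_of_nonneg_left (hgb x) (abs_nonneg (a x))
  have h2 := haw x
  have h3 : η * (a x ^ 2 * ‖φ x‖ ^ 2) ≤ η * (C * w x * ‖φ x‖ ^ 2) := by gcongr
  have h4 : 2 * (|a x| * (‖φ x‖ * ‖ψ x‖)) ≤ η * (a x ^ 2 * ‖φ x‖ ^ 2) + ‖ψ x‖ ^ 2 / η := by
    have : η * (a x ^ 2 * ‖φ x‖ ^ 2) + ‖ψ x‖ ^ 2 / η - 2 * (|a x| * (‖φ x‖ * ‖ψ x‖))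
      = (η * (|a x| * ‖φ x‖) - ‖ψ x‖) ^ 2 / η := by
      rw [← sq_abs (a x)]; field_simp; ring
    have : 0 ≤ (η * (|a x| * ‖φ x‖) - ‖ψ x‖) ^ 2 / η := by positivity
    linarith
  linarith

lemma dw_cont {w : E3 → ℝ} (hw : ContDiff ℝ ∞ w) (j : Fin 3) :
    Continuous (fun x => fderiv ℝ w x (ee j)) :=
  (hw.continuous_fderiv (by simp)).clm_apply continuous_const

lemma dw_supp {w : E3 → ℝ} (hc : HasCompactSupport w) (j : Fin 3) :
    HasCompactSupport (fun x => fderiv ℝ w x (ee j)) :=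
  hc.fderiv_apply (𝕜 := ℝ) (ee j)

lemma P_bound {w : E3 → ℝ} (hw : ContDiff ℝ ∞ w) (hc : HasCompactSupport w) {C : ℝ}
    (h : ∀ j x, (fderiv ℝ w x (ee j)) ^ 2 ≤ C * w x) (φ : S3) :
    |2 * P w φ| ≤ 3 * C * (∫ x, w x * ‖φ x‖ ^ 2) + ∑ j, q (Dj j φ) := by
  unfold P
  rw [Finset.mul_sum]
  refine (Finset.abs_sum_le_sum_abs _ _).trans ?_
  have : ∀ j ∈ Finset.univ, |2 * ∫ x, fderiv ℝ w x (ee j) * inner ℝ (φ x) (Complex.I * Dj j φ x)|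
      ≤ C * (∫ x, w x * ‖φ x‖ ^ 2) + q (Dj j φ) := by
    intro j _
    have := tb (dw_cont hw j) (dw_supp hc j) hw.continuous hc (h j) φ (Dj j φ)
      (g := fun x => inner ℝ (φ x) (Complex.I * Dj j φ x)) (by fun_prop)
      (fun x => inner_I_le _ _) one_pos
    simpa using this
  refine (Finset.sum_le_sum this).trans ?_
  rw [Finset.sum_add_distrib, Finset.sum_const]
  simp only [Finset.card_univ, Fintype.card_fin, nsmul_eq_mul]
  push_cast
  linarith

lemma P_diff {w : E3 → ℝ} (hw : ContDiff ℝ ∞ w) (hc : HasCompactSupport w) {C : ℝ}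
    (h : ∀ j x, (fderiv ℝ w x (ee j)) ^ 2 ≤ C * w x) (φ φ0 : S3) {η : ℝ} (hη : 0 < η) :
    |2 * P w φ - 2 * P w φ0| ≤ 3 * (η * C * (∫ x, w x * ‖φ x‖ ^ 2))
      + (∑ j, q (Dj j (φ - φ0))) / η + 3 * (q (φ - φ0) / η)
      + η * C * ∑ j, ∫ x, w x * ‖Dj j φ0 x‖ ^ 2 := by
  unfold P
  rw [Finset.mul_sum, Finset.mul_sum, ← Finset.sum_sub_distrib]
  refine (Finset.abs_sum_le_sum_abs _ _).trans ?_
  have hi : ∀ (j : Fin 3) (α β : S3), Integrable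
      (fun x => fderiv ℝ w x (ee j) * inner ℝ (α x) (Complex.I * β x)) := by
    intro j α β
    have := dw_cont hw j
    exact Continuous.integrable_of_hasCompactSupport (by fun_prop) (dw_supp hc j).mul_right
  have : ∀ j ∈ Finset.univ, |2 * (∫ x, fderiv ℝ w x (ee j) * inner ℝ (φ x) (Complex.I * Dj j φ x))
        - 2 * ∫ x, fderiv ℝ w x (ee j) * inner ℝ (φ0 x) (Complex.I * Dj j φ0 x)|
      ≤ (η * C * (∫ x, w x * ‖φ x‖ ^ 2) + q (Dj j (φ - φ0)) / η)
        + (η * C * (∫ x, w x * ‖Dj j φ0 x‖ ^ 2) + q (φ - φ0) / η) := by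
    intro j _
    have t1 := tb (dw_cont hw j) (dw_supp hc j) hw.continuous hc (h j) φ (Dj j (φ - φ0))
      (g := fun x => inner ℝ (φ x) (Complex.I * Dj j (φ - φ0) x)) (by fun_prop)
      (fun x => inner_I_le _ _) hη
    have t2 := tb (dw_cont hw j) (dw_supp hc j) hw.continuous hc (h j) (Dj j φ0) (φ - φ0)
      (g := fun x => inner ℝ ((φ - φ0) x) (Complex.I * Dj j φ0 x)) (by fun_prop)
      (fun x => (inner_I_le _ _).trans (mul_comm _ _).le) hη
    have e : 2 * (∫ x, fderiv ℝ w x (ee j) * inner ℝ (φ x) (Complex.I * Dj j φ x))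
        - 2 * ∫ x, fderiv ℝ w x (ee j) * inner ℝ (φ0 x) (Complex.I * Dj j φ0 x)
        = 2 * (∫ x, fderiv ℝ w x (ee j) * inner ℝ (φ x) (Complex.I * Dj j (φ - φ0) x))
        + 2 * ∫ x, fderiv ℝ w x (ee j) * inner ℝ ((φ - φ0) x) (Complex.I * Dj j φ0 x) := by
      rw [← mul_sub, ← mul_add, ← integral_sub (hi _ _ _) (hi _ _ _),
        ← integral_add (hi _ _ _) (hi _ _ _)]
      congr 1
      refine integral_congr_ae (Eventually.of_forall fun x => ?_)
      simp only [map_sub, _root_.sub_apply, mul_sub, inner_sub_left, inner_sub_right]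
      ring
    rw [e]
    exact (abs_add_le _ _).trans (add_le_add t1 t2)
  refine (Finset.sum_le_sum this).trans ?_
  simp only [Finset.sum_add_distrib, Finset.sum_const, ← Finset.sum_div, ← Finset.mul_sum,
    Finset.card_univ, Fintype.card_fin, nsmul_eq_mul]
  push_cast
  linarith

lemma X_bound {V : E3 → ℝ} {σ : ℝ} (hσ : |σ| = 1) {u u1 : ℝ → S3} (h : Sol V σ u u1 0)
    {w : E3 → ℝ} (hw : ContDiff ℝ ∞ w) (hc : HasCompactSupport w) {C : ℝ}
    (hC : ∀ j x, (fderiv ℝ w x (ee j)) ^ 2 ≤ C * w x) {B δ s : ℝ} (hδ : 0 ≤ δ)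
    (hδC : δ * (3 * C) ≤ 1 / 2) (hC0 : 0 ≤ C) (hw0 : ∀ x, 0 ≤ w x) (hB0 : 0 ≤ B)
    (hB : ∀ τ ∈ Set.Icc (s - δ) (s + δ), ∑ j, q (Dj j (u τ)) ≤ B) :
    ∀ τ ∈ Set.Icc (s - δ) (s + δ),
      ∫ x, w x * ‖u τ x‖ ^ 2 ≤ 2 * (∫ x, w x * ‖u s x‖ ^ 2) + 2 * (δ * B) := by
  have hd := fun τ => time_deriv' h hw hc τ
  set X : ℝ → ℝ := fun τ => ∫ x, w x * ‖u τ x‖ ^ 2 with hX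
  have hcont : Continuous X := continuous_iff_continuousAt.mpr fun τ => (hd τ).continuousAt
  obtain ⟨m, hm, hmax⟩ := isCompact_Icc.exists_isMaxOn
    (s := Set.Icc (s - δ) (s + δ)) ⟨s, by linarith, by linarith⟩ hcont.continuousOn
  have hX0 : 0 ≤ X m := integral_nonneg fun x => mul_nonneg (hw0 x) (by positivity)
  have hmv := (convex_Icc (s - δ) (s + δ)).norm_image_sub_le_of_norm_hasDerivWithin_le
    (f := X) (C := 3 * C * X m + B) (x := s) (y := m)
    (fun τ _ => (hd τ).hasDerivWithinAt) ?_ ⟨by linarith, by linarith⟩ hm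
  · have h1 : ‖m - s‖ ≤ δ := by
      rw [Real.norm_eq_abs, abs_le]; exact ⟨by linarith [hm.1], by linarith [hm.2]⟩
    have h2 : (3 * C * X m + B) * ‖m - s‖ ≤ (3 * C * X m + B) * δ := by gcongr
    have h3 := (le_abs_self _).trans (hmv.trans h2)
    have h4 : δ * (3 * C) * X m ≤ 1 / 2 * X m := by gcongr
    intro τ hτ
    have h5 : X τ ≤ X m := hmax hτ
    change X τ ≤ 2 * X s + 2 * (δ * B)
    nlinarith
  · intro τ hτ
    have h1 := P_bound hw hc hC (u τ)
    have h2 := hB τ hτ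
    have h3 : X τ ≤ X m := hmax hτ
    have h4 : 3 * C * X τ ≤ 3 * C * X m := by gcongr
    have e : ‖-2 * σ * P w (u τ) + 2 * ∫ x, w x * inner ℝ (u τ x) ((0 : S3) x)‖
        = |2 * P w (u τ)| := by
      simp [abs_mul, hσ]
    rw [e]
    linarith

lemma main_est {V : E3 → ℝ} {CV : ℝ} (hV : ∀ x, |V x| ≤ CV) {u u1 : ℝ → S3}
    (h : Sol V 1 u u1 0) (s : ℝ) {C : ℝ} (hC0 : 0 ≤ C) : ∃ K δ, 0 < δ ∧ ∀ w : E3 → ℝ,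
    ContDiff ℝ ∞ w → HasCompactSupport w → (∀ x, 0 ≤ w x) → (∀ x, w x ≤ ‖x‖ ^ 2) →
    (∀ j x, (fderiv ℝ w x (ee j)) ^ 2 ≤ C * w x) → ∀ t, |t - s| ≤ δ →
    |(∫ x, w x * ‖u t x‖ ^ 2) - (∫ x, w x * ‖u s x‖ ^ 2) - (t - s) * (-2 * P w (u s))|
      ≤ K * √|t - s| * |t - s| := by
  have hCV : 0 ≤ CV := (abs_nonneg _).trans (hV 0)
  have hσ : (1 : ℝ) ^ 2 = 1 := by norm_num
  obtain ⟨M, hM⟩ := good_compact (u := u) (u1 := u1) (isCompact_Icc (a := s - 1) (b := s + 1))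
    (fun t _ => all_good hV hσ h t)
  have hM0 : 0 ≤ M := (q_nonneg _).trans (hM s ⟨by linarith, by linarith⟩).1
  set B := (1 / 1 + CV) * M + 1 * (2 * M) with hBdef
  have hB0 : 0 ≤ B := by positivity
  have hB : ∀ τ ∈ Set.Icc (s - 1) (s + 1), ∑ j, q (Dj j (u τ)) ≤ B := by
    intro τ hτ
    have h1 := grad_bound hV hσ (h.eq τ) one_pos
    have h2 := hM τ hτ
    rw [sub_zero] at h1
    have h3 : (1 / 1 + CV) * q (u τ) ≤ (1 / 1 + CV) * M := by gcongr; exact h2.1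
    linarith [h2.2]
  set δ := min 1 (1 / (6 * C + 6)) with hδ
  have hδ0 : 0 < δ := by positivity
  have hδ1 : δ ≤ 1 := min_le_left _ _
  have hδC : δ * (3 * C) ≤ 1 / 2 := by
    have : δ ≤ 1 / (6 * C + 6) := min_le_right _ _
    calc δ * (3 * C) ≤ 1 / (6 * C + 6) * (3 * C) := by gcongr
      _ ≤ 1 / 2 := by
        rw [div_mul_eq_mul_div, div_le_div_iff₀ (by positivity) (by norm_num)]; linarith
  set Xs := 2 * (∫ x, ‖x‖ ^ 2 * ‖u s x‖ ^ 2) + 2 * (δ * B) with hXs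
  set Y := ∑ j, ∫ x, ‖x‖ ^ 2 * ‖Dj j (u s) x‖ ^ 2 with hY
  refine ⟨3 * (C * Xs) + (8 + 4 * CV) * M + 12 * M + C * Y, δ, hδ0, ?_⟩
  intro w hw hc hw0 hwx hwC t ht
  have hwle : ∀ φ : S3, ∫ x, w x * ‖φ x‖ ^ 2 ≤ ∫ x, ‖x‖ ^ 2 * ‖φ x‖ ^ 2 := by
    intro φ
    have := hw.continuous
    refine integral_mono (Continuous.integrable_of_hasCompactSupport (by fun_prop) hc.mul_right)
      (int_x_sq φ) fun x => ?_
    exact mul_le_mul_of_nonneg_right (hwx x) (by positivity)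
  rcases eq_or_ne t s with rfl | hts
  · simp
  set r := |t - s| with hr
  have hr0 : 0 < r := abs_pos.mpr (sub_ne_zero.mpr hts)
  have hsub : Set.Icc (s - δ) (s + δ) ⊆ Set.Icc (s - 1) (s + 1) :=
    Set.Icc_subset_Icc (by linarith) (by linarith)
  have hsub2 : Set.Icc (s - r) (s + r) ⊆ Set.Icc (s - δ) (s + δ) :=
    Set.Icc_subset_Icc (by linarith) (by linarith)
  have hXb : ∀ τ ∈ Set.Icc (s - δ) (s + δ), ∫ x, w x * ‖u τ x‖ ^ 2 ≤ Xs := by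
    intro τ hτ
    have := X_bound (by simp) h hw hc hwC hδ0.le hδC hC0 hw0 hB0 (fun τ hτ => hB τ (hsub hτ)) τ hτ
    linarith [hwle (u s)]
  have hYb : ∑ j, ∫ x, w x * ‖Dj j (u s) x‖ ^ 2 ≤ Y := Finset.sum_le_sum fun j _ => hwle _
  have hd := fun τ => time_deriv' h hw hc τ
  set X : ℝ → ℝ := fun τ => ∫ x, w x * ‖u τ x‖ ^ 2 with hX
  have hmv := (convex_Icc (s - r) (s + r)).norm_image_sub_le_of_norm_hasDerivWithin_le
    (f := fun τ => X τ - τ * (-2 * P w (u s)))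
    (C := (3 * (C * Xs) + (8 + 4 * CV) * M + 12 * M + C * Y) * √r) (x := s) (y := t)
    (fun τ _ => ((hd τ).sub ((hasDerivAt_id τ).mul_const (-2 * P w (u s)))).hasDerivWithinAt) ?_
    ⟨by linarith, by linarith⟩ ⟨by linarith [neg_abs_le (t - s)], by linarith [le_abs_self (t - s)]⟩
  · rw [Real.norm_eq_abs, Real.norm_eq_abs] at hmv
    convert hmv using 2
    change _ = X t - t * (-2 * P w (u s)) - (X s - s * (-2 * P w (u s)))
    simp only [hX]
    ring
  intro τ hτ
  have hτδ := hsub2 hτ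
  have hτ1 := hsub hτδ
  have hr1 : r ≤ 1 := ht.trans hδ1
  set η := √r with hηdef
  have hη : 0 < η := Real.sqrt_pos.mpr hr0
  have hηr : r = η ^ 2 := (Real.sq_sqrt hr0.le).symm
  have hη1 : η ≤ 1 := by nlinarith
  have hPd := P_diff hw hc hwC (u τ) (u s) hη
  have hs1 : s ∈ Set.Icc (s - 1) (s + 1) := ⟨by linarith, by linarith⟩
  have huI : Set.uIcc s τ ⊆ Set.Icc (s - 1) (s + 1) := Set.uIcc_subset_Icc hs1 hτ1
  have hq : q (u τ - u s) ≤ 4 * r ^ 2 * M := by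
    have := energy2 hV hσ (h.sub_const s) (s := s) (t := τ) (S := 2 * M + 2 * M) (S1 := M)
      (fun τ' hτ' => by linarith [q_sub (u τ') (u s), (hM τ' (huI hτ')).1, (hM s hs1).1])
      (fun τ' hτ' => (hM τ' (huI hτ')).2)
    simp only [sub_self, q_zero] at this
    have h2 : (τ - s) ^ 2 ≤ r ^ 2 := by
      apply sq_le_sq' <;> linarith [hτ.1, hτ.2]
    have h3 : 4 * (τ - s) ^ 2 * q (u1 s) ≤ 4 * r ^ 2 * M := by
      have := q_nonneg (u1 s)
      gcongr
      exact (hM s hs1).2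
    linarith
  have hgr : ∑ j, q (Dj j (u τ - u s)) ≤ (8 + 4 * CV) * M * r := by
    have h1 := grad_bound hV hσ ((h.sub_const s).eq τ) hr0
    have h2 : q (u1 τ - u1 s) ≤ 4 * M := by
      linarith [q_sub (u1 τ) (u1 s), (hM τ hτ1).2, (hM s hs1).2]
    have h3 : (1 / r + CV) * q (u τ - u s) ≤ (1 / r + CV) * (4 * r ^ 2 * M) := by gcongr
    have h4 : (1 / r + CV) * (4 * r ^ 2 * M) = 4 * r * M + 4 * CV * M * (r * r) := by
      field_simp
    have h5 : 4 * CV * M * (r * r) ≤ 4 * CV * M * (r * 1) := by gcongr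
    have h6 : r * q (u1 τ - u1 s) ≤ r * (4 * M) := by gcongr
    linarith
  have a1 : η * C * (∫ x, w x * ‖u τ x‖ ^ 2) ≤ η * C * Xs := by gcongr; exact hXb τ hτδ
  have a2 : (∑ j, q (Dj j (u τ - u s))) / η ≤ (8 + 4 * CV) * M * η := by
    rw [div_le_iff₀ hη]; rw [hηr] at hgr; linarith
  have a3 : q (u τ - u s) / η ≤ 4 * M * η := by
    rw [div_le_iff₀ hη]
    rw [hηr] at hq
    have : η ^ 2 * η ^ 2 ≤ 1 * η ^ 2 := by gcongr; nlinarith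
    nlinarith
  have a4 : η * C * (∑ j, ∫ x, w x * ‖Dj j (u s) x‖ ^ 2) ≤ η * C * Y := by gcongr
  have e : ‖-2 * 1 * P w (u τ) + 2 * (∫ x, w x * inner ℝ (u τ x) ((0 : S3) x))
      - 1 * (-2 * P w (u s))‖ = |2 * P w (u τ) - 2 * P w (u s)| := by
    simp only [SchwartzMap.zero_apply, inner_zero_right, mul_zero, integral_zero, Real.norm_eq_abs]
    rw [← abs_neg]
    congr 1
    ring
  rw [e]
  linarith

end Dil

namespace Dil
open Filter Topology
open scoped LineDeriv

lemma inner_I_eq (z y : ℂ) : inner ℝ z (Complex.I * y) = -((starRingEnd ℂ) z * y).im := by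
  simp [Complex.inner, Complex.mul_re, Complex.mul_im]; ring

lemma coord_le (x : E3) (j : Fin 3) : |x j| ≤ ‖x‖ := by
  simpa using PiLp.norm_apply_le x j

lemma int_j (φ ψ : S3) (j : Fin 3) :
    Integrable (fun x : E3 => (starRingEnd ℂ) (φ x) * ((x j : ℂ) * ψ x)) := by
  refine int_of_le φ ψ (Continuous.mul (Complex.continuous_conj.comp φ.continuous)
    (by fun_prop)) 1 fun x => ?_
  rw [norm_mul, norm_mul, RCLike.norm_conj, Complex.norm_real, Real.norm_eq_abs, one_mul]
  have h1 : |x j| ≤ 1 + ‖x‖ ^ 2 := by nlinarith [coord_le x j, sq_nonneg (‖x‖ - 1)]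
  have := mul_le_mul_of_nonneg_right h1 (by positivity : 0 ≤ ‖φ x‖ * ‖ψ x‖)
  linarith

lemma G_eq (φ : S3) : -2 * ∑ j, ∫ x : E3, (2 * x j) * inner ℝ (φ x) (Complex.I * Dj j φ x)
    = 4 * (∫ x : E3, (starRingEnd ℂ) (φ x) * ∑ j, (x j : ℂ) * Dj j φ x).im := by
  simp_rw [Finset.mul_sum]
  rw [integral_finsetSum _ (fun j _ => int_j φ (Dj j φ) j), Complex.im_sum, Finset.mul_sum]
  refine Finset.sum_congr rfl fun j _ => ?_
  have : (∫ x : E3, (starRingEnd ℂ) (φ x) * ((x j : ℂ) * Dj j φ x)).im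
      = ∫ x : E3, ((starRingEnd ℂ) (φ x) * ((x j : ℂ) * Dj j φ x)).im :=
    (integral_im (int_j φ (Dj j φ) j)).symm
  rw [this, ← integral_const_mul, ← integral_const_mul]
  refine integral_congr_ae (Eventually.of_forall fun x => ?_)
  simp only [inner_I_eq]
  rw [show (starRingEnd ℂ) (φ x) * ((x j : ℂ) * Dj j φ x)
    = (x j : ℂ) * ((starRingEnd ℂ) (φ x) * Dj j φ x) by ring, Complex.im_ofReal_mul]
  ring

lemma P_lim {w : ℕ → E3 → ℝ} {C : ℝ} (hC : 0 ≤ C) (hw : ∀ n, ContDiff ℝ ∞ (w n))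
    (hwx : ∀ n x, w n x ≤ ‖x‖ ^ 2)
    (hd : ∀ (n : ℕ) j x, ‖x‖ < (n : ℝ) + 1 → fderiv ℝ (w n) x (ee j) = 2 * x j)
    (hwC : ∀ n j x, (fderiv ℝ (w n) x (ee j)) ^ 2 ≤ C * w n x) (φ : S3) :
    Tendsto (fun n => P (w n) φ) atTop
      (𝓝 (∑ j, ∫ x : E3, (2 * x j) * inner ℝ (φ x) (Complex.I * Dj j φ x))) := by
  unfold P
  refine tendsto_finsetSum _ fun j _ => ?_
  refine tendsto_integral_of_dominated_convergence
    (fun x => (C + 1) * ((1 + ‖x‖ ^ 2) * (‖φ x‖ * ‖Dj j φ x‖))) ?_ ?_ ?_ ?_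
  · intro n
    have := dw_cont (hw n) j
    exact Continuous.aestronglyMeasurable (by fun_prop)
  · exact (int_base φ (Dj j φ)).const_mul _
  · intro n
    refine Eventually.of_forall fun x => ?_
    rw [norm_mul, Real.norm_eq_abs, Real.norm_eq_abs]
    have h1 : |fderiv ℝ (w n) x (ee j)| ≤ (C + 1) * (1 + ‖x‖ ^ 2) := by
      have h2 := hwC n j x
      have h3 := mul_le_mul_of_nonneg_left (hwx n x) hC
      rw [← sq_abs] at h2
      nlinarith [sq_nonneg (|fderiv ℝ (w n) x (ee j)| - 1), sq_nonneg ‖x‖]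
    calc _ ≤ (C + 1) * (1 + ‖x‖ ^ 2) * (‖φ x‖ * ‖Dj j φ x‖) :=
          mul_le_mul h1 (inner_I_le _ _) (abs_nonneg _) (by positivity)
      _ = _ := by ring
  · refine Eventually.of_forall fun x => ?_
    refine tendsto_const_nhds.congr' ?_
    filter_upwards [ev_norm x] with n hn
    rw [hd n j x hn]

lemma X_lim {w : ℕ → E3 → ℝ} (hw : ∀ n, ContDiff ℝ ∞ (w n)) (hw0 : ∀ n x, 0 ≤ w n x)
    (hwx : ∀ n x, w n x ≤ ‖x‖ ^ 2)
    (hd : ∀ (n : ℕ) x, ‖x‖ ≤ (n : ℝ) + 1 → w n x = ‖x‖ ^ 2) (φ : S3) :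
    Tendsto (fun n => ∫ x, w n x * ‖φ x‖ ^ 2) atTop (𝓝 (∫ x, ‖x‖ ^ 2 * ‖φ x‖ ^ 2)) := by
  refine tendsto_integral_of_dominated_convergence (fun x => ‖x‖ ^ 2 * ‖φ x‖ ^ 2) ?_ ?_ ?_ ?_
  · intro n
    have := (hw n).continuous
    exact Continuous.aestronglyMeasurable (by fun_prop)
  · exact int_x_sq φ
  · intro n
    refine Eventually.of_forall fun x => ?_
    rw [Real.norm_of_nonneg (mul_nonneg (hw0 n x) (by positivity))]
    exact mul_le_mul_of_nonneg_right (hwx n x) (by positivity)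
  · refine Eventually.of_forall fun x => ?_
    refine tendsto_const_nhds.congr' ?_
    filter_upwards [ev_norm x] with n hn
    rw [hd n x hn.le]

lemma final {V : E3 → ℝ} {CV : ℝ} (hV : ∀ x, |V x| ≤ CV) {u u1 : ℝ → S3}
    (h : Sol V 1 u u1 0) (s : ℝ) :
    HasDerivAt (fun τ => ∫ x : E3, ‖x‖ ^ 2 * ‖u τ x‖ ^ 2)
      (4 * (∫ x : E3, (starRingEnd ℂ) (u s x) * ∑ j, (x j : ℂ) * Dj j (u s) x).im) s := by
  obtain ⟨C, hC0, hcut⟩ := cut2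
  choose w hw hc hw0 hwx hw1 hwd _ hwC using hcut
  obtain ⟨K, δ, hδ, hest⟩ := main_est hV h s hC0
  rw [← G_eq]
  set G := -2 * ∑ j, ∫ x : E3, (2 * x j) * inner ℝ (u s x) (Complex.I * Dj j (u s) x)
  have hlim : ∀ t, |t - s| ≤ δ →
      |(∫ x, ‖x‖ ^ 2 * ‖u t x‖ ^ 2) - (∫ x, ‖x‖ ^ 2 * ‖u s x‖ ^ 2) - (t - s) * G|
      ≤ K * √|t - s| * |t - s| := by
    intro t ht
    have l1 := X_lim hw hw0 hwx hw1 (u t)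
    have l2 := X_lim hw hw0 hwx hw1 (u s)
    have l3 := P_lim hC0 hw hwx hwd hwC (u s)
    have l := ((l1.sub l2).sub ((l3.const_mul (-2)).const_mul (t - s))).abs
    exact le_of_tendsto l (Eventually.of_forall fun n =>
      hest (w n) (hw n) (hc n) (hw0 n) (hwx n) (hwC n) t ht)
  rw [hasDerivAt_iff_isLittleO, Asymptotics.isLittleO_iff]
  intro c hc'
  have hK : Tendsto (fun t => K * √|t - s|) (𝓝 s) (𝓝 0) := by
    have : Continuous (fun t => K * √|t - s|) := by fun_prop
    simpa using this.tendsto s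
  filter_upwards [hK.eventually_le_const hc', Metric.closedBall_mem_nhds s hδ] with t h1 h2
  have h3 := hlim t (by simpa [Real.dist_eq] using h2)
  rw [Real.norm_eq_abs, Real.norm_eq_abs, smul_eq_mul]
  exact h3.trans (mul_le_mul_of_nonneg_right h1 (abs_nonneg _))

end Dil

theorem dilation_identity_first_order
    (V : EuclideanSpace ℝ (Fin 3) → ℝ)
    (hV : ContDiff ℝ ∞ V)
    (hVbdd : ∀ n : ℕ, ∃ C : ℝ, ∀ x, ‖iteratedFDeriv ℝ n V x‖ ≤ C)
    (ψ : ℝ → EuclideanSpace ℝ (Fin 3) → ℂ)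
    (hψ : ContDiff ℝ ∞ (Function.uncurry ψ))
    (hSchwartz : ∀ (t : ℝ) (n : ℕ), ∃ φ : SchwartzMap (EuclideanSpace ℝ (Fin 3)) ℂ,
      ∀ x, iteratedDeriv n (fun τ => ψ τ x) t = φ x)
    (heq : ∀ (t : ℝ) (x : EuclideanSpace ℝ (Fin 3)),
      Complex.I * deriv (fun τ => ψ τ x) t
        = -(∑ j : Fin 3, fderiv ℝ (fderiv ℝ (ψ t)) x (EuclideanSpace.single j 1)
              (EuclideanSpace.single j 1))
          + (V x : ℂ) * ψ t x) :
    ∀ t : ℝ,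
      HasDerivAt (fun τ : ℝ => ∫ x : EuclideanSpace ℝ (Fin 3), ‖x‖ ^ 2 * ‖ψ τ x‖ ^ 2)
        (4 * (∫ x : EuclideanSpace ℝ (Fin 3),
            (starRingEnd ℂ) (ψ t x)
              * ∑ j : Fin 3, (x j : ℂ)
                  * fderiv ℝ (ψ t) x (EuclideanSpace.single j 1)).im)
        t := by
  obtain ⟨CV, hCV⟩ := hVbdd 0
  have hCV' : ∀ x, |V x| ≤ CV := by
    intro x
    have := hCV x
    rwa [norm_iteratedFDeriv_zero, Real.norm_eq_abs] at this
  choose u hu using fun t => hSchwartz t 0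
  choose u1 hu1 using fun t => hSchwartz t 1
  simp only [iteratedDeriv_zero, iteratedDeriv_one] at hu hu1
  have hder : ∀ t x, HasDerivAt (fun τ => ψ τ x)
      (fderiv ℝ (Function.uncurry ψ) (t, x) (1, 0)) t := by
    intro t x
    have h1 : HasFDerivAt (Function.uncurry ψ) (fderiv ℝ (Function.uncurry ψ) (t, x)) (t, x) :=
      ((hψ.differentiable (by simp)) (t, x)).hasFDerivAt
    have h2 : HasDerivAt (fun τ : ℝ => (τ, x)) ((1 : ℝ), (0 : EuclideanSpace ℝ (Fin 3))) t :=
      (hasDerivAt_id t).prodMk (hasDerivAt_const t x)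
    exact h1.comp_hasDerivAt t h2
  have hfun : ψ = fun t => ⇑(u t) := by
    funext t x; exact hu t x
  have hu1' : ∀ t x, u1 t x = fderiv ℝ (Function.uncurry ψ) (t, x) (1, 0) := fun t x => by
    rw [← hu1, (hder t x).deriv]
  have hsol : Dil.Sol V 1 u u1 0 := by
    refine ⟨?_, ?_, ?_, ?_⟩
    · have := hψ.continuous
      rw [hfun] at this
      exact this
    · simp only [hu1']
      exact (hψ.continuous_fderiv (by simp)).clm_apply continuous_const
    · intro t x
      have := hder t x
      rw [← hu1'] at this
      simpa only [hu] using this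
    · intro t x
      have h1 := heq t x
      rw [hu1 t x] at h1
      simp only [Dil.DDj_apply, sub_zero]
      have h2 : ψ t = u t := funext (hu t)
      rw [h2] at h1
      have h3 : u1 t x = -Complex.I * (Complex.I * u1 t x) := by
        rw [← mul_assoc, neg_mul, Complex.I_mul_I]; simp
      rw [h3, h1]
      simp only [Dil.ee]
      push_cast
      ring
  intro t
  have := Dil.final hCV' hsol t
  simp only [Dil.Dj_apply, Dil.ee] at this
  simpa only [hfun] using this
end
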